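/- For every positive integer n, ∑_{|r| < 2√n} t(4n − r²) equals −4 if n is a perfect square, 2 if 4n+1 is a perfect square, and 0 otherwise, where the sum is over integers r with r² < 4n. -/

import Mathlib

noncomputable section

/-- The weight `k` lattice Eisenstein sum `∑_{(c,d) ≠ (0,0)} 1/(cτ+d)^k`. -/
noncomputable def latticeG (k : ℕ) (τ : ℂ) : ℂ :=
  ∑' p : ℤ × ℤ, if p = 0 then 0 else 1 / ((p.1 : ℂ) * τ + (p.2 : ℂ)) ^ k

/-- The modular `j`-invariant `j = 1728 E₄³/(E₄³ - E₆²) = 1728 g₂³/(g₂³ - 27 g₃²)`. -/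
noncomputable def jInv (τ : ℂ) : ℂ :=
  1728 * (60 * latticeG 4 τ) ^ 3 /
    ((60 * latticeG 4 τ) ^ 3 - 27 * (140 * latticeG 6 τ) ^ 2)

/-- The value of the binary quadratic form `aX² + bXY + cY²` (encoded `(a, b, c)`) at `(x, y)`. -/
def formVal (f : ℤ × ℤ × ℤ) (x y : ℤ) : ℤ :=
  f.1 * x ^ 2 + f.2.1 * x * y + f.2.2 * y ^ 2

/-- `f` is a positive definite integral binary quadratic form of discriminant `-d`. -/
def IsForm (d : ℤ) (f : ℤ × ℤ × ℤ) : Prop :=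
  0 < f.1 ∧ f.2.1 ^ 2 - 4 * f.1 * f.2.2 = -d

/-- Two forms are `SL₂(ℤ)`-equivalent. -/
def FormRel (f f' : ℤ × ℤ × ℤ) : Prop :=
  ∃ g : Matrix.SpecialLinearGroup (Fin 2) ℤ,
    ∀ x y : ℤ,
      formVal f' x y =
        formVal f (g.1 0 0 * x + g.1 0 1 * y) (g.1 1 0 * x + g.1 1 1 * y)

/-- The set of `SL₂(ℤ)`-classes of positive definite forms of discriminant `-d`. -/
abbrev FormClass (d : ℤ) :=
  Quot (fun f f' : { f : ℤ × ℤ × ℤ // IsForm d f } => FormRel f.1 f'.1)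

/-- The root `α_Q = (-b + i√d)/(2a)` in the upper half plane of `Q(X,1) = 0`. -/
noncomputable def formRoot (f : ℤ × ℤ × ℤ) : ℂ :=
  (-(f.2.1 : ℂ) + Complex.I * ((Real.sqrt ((4 * f.1 * f.2.2 - f.2.1 ^ 2 : ℤ) : ℝ) : ℝ) : ℂ)) /
    (2 * (f.1 : ℂ))

/-- `w_Q`: the order of the stabilizer of the form `f` in `PSL₂(ℤ)`, i.e. half the order of
its stabilizer in `SL₂(ℤ)` (the stabilizer always contains `±1`). -/
noncomputable def formWt (f : ℤ × ℤ × ℤ) : ℕ :=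
  Nat.card { g : Matrix.SpecialLinearGroup (Fin 2) ℤ //
    ∀ x y : ℤ,
      formVal f x y =
        formVal f (g.1 0 0 * x + g.1 0 1 * y) (g.1 1 0 * x + g.1 1 1 * y) } / 2

/-- The trace of singular moduli `t(d) = ∑_{Q ∈ Q_d/Γ} (j(α_Q) - 744)/w_Q`, with the
conventions `t(0) = 2`, `t(-1) = -1` and `t(d) = 0` for `d < -1` or `d ≡ 1, 2 (mod 4)`. -/
noncomputable def traceSM (d : ℤ) : ℝ :=
  if d = 0 then 2
  else if d = -1 then -1
  else if d < -1 ∨ d % 4 = 1 ∨ d % 4 = 2 then 0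
  else (∑ᶠ cl : FormClass d,
    (jInv (formRoot (Quot.out cl).1) - 744) / (formWt (Quot.out cl).1 : ℂ)).re

end

namespace ZagierTrace

open UpperHalfPlane ModularForm MatrixGroups EisensteinSeries Derivative Filter Topology Asymptotics
open scoped Manifold

lemma latticeG_eq (k : ℕ) (hk : 3 ≤ k) (τ : ℍ) :
    latticeG k τ = 2 * riemannZeta k * E hk τ := by
  have h1 : latticeG k τ = ∑' v : Fin 2 → ℤ, eisSummand k v τ := by
    rw [latticeG, ← (finTwoArrowEquiv ℤ).symm.tsum_eq]
    refine tsum_congr fun p ↦ ?_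
    split_ifs with h
    · simp [h, eisSummand, finTwoArrowEquiv, zero_pow (show k ≠ 0 by lia)]
    · simp [eisSummand, finTwoArrowEquiv]
  have h2 : E hk τ = (1 / 2 : ℂ) * eisensteinSeries (N := 1) 0 k τ := rfl
  rw [h1, h2, tsum_eisSummand_eq_riemannZeta_mul_eisensteinSeries hk]
  ring

lemma riemannZeta_six_eq : riemannZeta 6 = (Real.pi : ℂ) ^ 6 / 945 := by
  have h := riemannZeta_two_mul_nat (k := 3) (by norm_num)
  norm_num [show bernoulli 6 = 1 / 42 by decide +kernel, Nat.factorial] at h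
  rw [h]
  ring

/-- The `j`-invariant as a function on the upper half plane. -/
noncomputable def jH (τ : ℍ) : ℂ := E₄ τ ^ 3 / discriminant τ

lemma jInv_eq (τ : ℍ) : jInv τ = jH τ := by
  have h4 : riemannZeta (4 : ℕ) = (Real.pi : ℂ) ^ 4 / 90 := by
    exact_mod_cast riemannZeta_four
  have h6 : riemannZeta (6 : ℕ) = (Real.pi : ℂ) ^ 6 / 945 := by
    exact_mod_cast riemannZeta_six_eq
  have hD := discriminant_eq_E₄_cube_sub_E₆_sq τ
  have hD0 := discriminant_ne_zero τ
  rw [jInv, jH, latticeG_eq 4 (by norm_num), latticeG_eq 6 (by norm_num), h4, h6]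
  have hpi : (Real.pi : ℂ) ≠ 0 := by exact_mod_cast Real.pi_ne_zero
  have e : (60 * (2 * ((Real.pi : ℂ) ^ 4 / 90) * E₄ τ)) ^ 3
      - 27 * (140 * (2 * ((Real.pi : ℂ) ^ 6 / 945) * E₆ τ)) ^ 2
      = 4096 * Real.pi ^ 12 * discriminant τ := by
    rw [hD]; ring
  rw [e]
  field_simp
  ring

lemma jH_sub_1728 (τ : ℍ) : jH τ - 1728 = E₆ τ ^ 2 / discriminant τ := by
  have hD := discriminant_eq_E₄_cube_sub_E₆_sq τ
  have hD0 := discriminant_ne_zero τ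
  rw [jH, div_sub' hD0, div_left_inj' hD0, hD]
  ring

/-- The nome `q = exp (2πiτ)`. -/
noncomputable abbrev qp (τ : ℍ) : ℂ := Function.Periodic.qParam 1 τ

lemma qp_ne_zero (τ : ℍ) : qp τ ≠ 0 := Function.Periodic.qParam_ne_zero _

lemma tendsto_qp : Tendsto qp atImInfty (𝓝 0) := qParam_tendsto_atImInfty one_pos

lemma isBigO_qExpansion {k : ℤ} (f : ModularForm 𝒮ℒ k) (n : ℕ) :
    (fun τ ↦ f τ - ∑ i ∈ Finset.range n, (qExpansion 1 f).coeff i * qp τ ^ i)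
      =O[atImInfty] fun τ ↦ qp τ ^ n := by
  have h := (hasFPowerSeriesOnBall_cuspFunction (h := 1) (f := f)
    (c := fun i ↦ (qExpansion 1 f).coeff i) one_pos
    (ModularFormClass.analyticAt_cuspFunction_zero f one_pos one_mem_strictPeriods_SL)
    (fun τ ↦ ModularForm.hasSum_qExpansion f one_pos one_mem_strictPeriods_SL τ))
  have h2 := (h.hasFPowerSeriesAt.isBigO_sub_partialSum_pow n).comp_tendsto tendsto_qp
  refine (isBigO_norm_right.mp ?_)
  refine h2.congr' (Eventually.of_forall fun τ ↦ ?_) (Eventually.of_forall fun τ ↦ ?_)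
  · simp only [Function.comp, zero_add, FormalMultilinearSeries.partialSum]
    rw [eq_cuspFunction τ one_ne_zero
      (SlashInvariantFormClass.periodic_comp_ofComplex f one_mem_strictPeriods_SL)]
    simp [mul_comm]
  · simp

lemma E₄_qExpansion_coeff_two : (qExpansion 1 E₄).coeff 2 = 2160 := by
  rw [E_qExpansion_coeff _ (by decide)]
  have : ArithmeticFunction.sigma 3 2 = 9 := by decide +kernel
  norm_num [show bernoulli 4 = -1 / 30 by decide +kernel, this]

lemma E₆_qExpansion_coeff_two : (qExpansion 1 E₆).coeff 2 = -16632 := by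
  rw [E_qExpansion_coeff _ (by decide)]
  have : ArithmeticFunction.sigma 5 2 = 33 := by decide +kernel
  norm_num [show bernoulli 6 = 1 / 42 by decide +kernel, this]

lemma isBigO_E₄ : (fun τ ↦ E₄ τ - (1 + 240 * qp τ + 2160 * qp τ ^ 2))
    =O[atImInfty] fun τ ↦ qp τ ^ 3 := by
  have h0 : (qExpansion 1 E₄).coeff 0 = 1 := by
    rw [E_qExpansion_coeff _ (by decide)]; simp
  refine (isBigO_qExpansion E₄ 3).congr_left fun τ ↦ ?_
  simp [Finset.sum_range_succ, h0, E₄_qExpansion_coeff_two, E₄_qExpansion_coeff_one]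

lemma isBigO_E₆ : (fun τ ↦ E₆ τ - (1 - 504 * qp τ - 16632 * qp τ ^ 2))
    =O[atImInfty] fun τ ↦ qp τ ^ 3 := by
  have h0 : (qExpansion 1 E₆).coeff 0 = 1 := by
    rw [E_qExpansion_coeff _ (by decide)]; simp
  refine (isBigO_qExpansion E₆ 3).congr_left fun τ ↦ ?_
  simp [Finset.sum_range_succ, h0, E₆_qExpansion_coeff_two, E₆_qExpansion_coeff_one]
  ring

lemma norm_qp (τ : ℍ) : ‖qp τ‖ = Real.exp (-2 * Real.pi * τ.im) := by
  rw [Function.Periodic.norm_qParam]; simp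

lemma qp_isBigO_discriminant : qp =O[atImInfty] discriminant := by
  rw [← isBigO_norm_left]
  exact exp_isBigO_discriminant.congr_left fun τ ↦ (norm_qp τ).symm

lemma qp_pow_tendsto (n : ℕ) (hn : n ≠ 0) : Tendsto (fun τ ↦ qp τ ^ n) atImInfty (𝓝 0) := by
  simpa [hn] using tendsto_qp.pow n

/-- Laurent expansion of `j` at the cusp. -/
lemma jH_isBigO : (fun τ ↦ jH τ - (qp τ)⁻¹ - 744) =O[atImInfty] qp := by
  set e₄ : ℍ → ℂ := fun τ ↦ E₄ τ - (1 + 240 * qp τ + 2160 * qp τ ^ 2) with he₄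
  set e₆ : ℍ → ℂ := fun τ ↦ E₆ τ - (1 - 504 * qp τ - 16632 * qp τ ^ 2) with he₆
  have h4 : e₄ =O[atImInfty] fun τ ↦ qp τ ^ 3 := isBigO_E₄
  have h6 : e₆ =O[atImInfty] fun τ ↦ qp τ ^ 3 := isBigO_E₆
  have t4 : Tendsto e₄ atImInfty (𝓝 0) := h4.trans_tendsto (qp_pow_tendsto 3 (by norm_num))
  have t6 : Tendsto e₆ atImInfty (𝓝 0) := h6.trans_tendsto (qp_pow_tendsto 3 (by norm_num))
  have bdd {u : ℂ × ℂ × ℂ → ℂ} (hu : Continuous u) :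
      (fun τ ↦ u (qp τ, e₄ τ, e₆ τ)) =O[atImInfty] fun _ ↦ (1 : ℂ) :=
    ((hu.tendsto (0, 0, 0)).comp
      (tendsto_qp.prodMk_nhds (t4.prodMk_nhds t6))).isBigO_one ℂ
  have key : (fun τ ↦ qp τ * E₄ τ ^ 3 - discriminant τ - 744 * qp τ * discriminant τ)
      =O[atImInfty] fun τ ↦ qp τ ^ 3 := by
    have hA := (isBigO_refl (fun τ ↦ qp τ ^ 3) atImInfty).mul (bdd (u := fun p ↦
      (197038)*p.1^0 + (16797471)*p.1^1 + (337672152)*p.1^2 + (1907064000)*p.1^3 +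
        (5738688000)*p.1^4) (by fun_prop))
    have hB := h4.mul (bdd (u := fun p ↦ (3 * (1 + 240 * p.1 + 2160 * p.1 ^ 2) ^ 2
      + 3 * (1 + 240 * p.1 + 2160 * p.1 ^ 2) * p.2.1 + p.2.1 ^ 2)
      * (p.1 - (1 + 744 * p.1) / 1728)) (by fun_prop))
    have hC := h6.mul (bdd (u := fun p ↦ (2 * (1 - 504 * p.1 - 16632 * p.1 ^ 2) + p.2.2)
      * (1 + 744 * p.1) / 1728) (by fun_prop))
    have h := (hA.add hB).add hC
    refine h.congr (fun τ ↦ ?_) fun τ ↦ mul_one _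
    rw [discriminant_eq_E₄_cube_sub_E₆_sq]
    simp only [he₄, he₆]
    ring
  have h := key.mul (isBigO_refl (fun τ ↦ (qp τ * discriminant τ)⁻¹) atImInfty)
  have e1 (τ) : (qp τ * E₄ τ ^ 3 - discriminant τ - 744 * qp τ * discriminant τ) *
      (qp τ * discriminant τ)⁻¹ = jH τ - (qp τ)⁻¹ - 744 := by
    have := qp_ne_zero τ
    have := discriminant_ne_zero τ
    rw [jH]; field_simp
  simp only [e1] at h
  refine h.trans ?_
  have h2 : (fun τ ↦ qp τ * (qp τ * (discriminant τ)⁻¹)) =O[atImInfty] fun τ ↦ qp τ * 1 := by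
    refine (isBigO_refl _ _).mul ?_
    have := qp_isBigO_discriminant.mul (isBigO_refl (fun τ ↦ (discriminant τ)⁻¹) atImInfty)
    refine this.congr_right fun τ ↦ mul_inv_cancel₀ (discriminant_ne_zero τ)
  refine h2.congr (fun τ ↦ ?_) (fun τ ↦ mul_one _)
  have := qp_ne_zero τ
  have := discriminant_ne_zero τ
  field_simp

/-- A weakly invariant holomorphic function bounded at `i∞` is a level one modular form. -/
lemma exists_modularForm {k : ℤ} {F : ℍ → ℂ} (hF : MDiff F)
    (hinv : ∀ (γ : SL(2, ℤ)) (τ : ℍ), F (γ • τ) = denom γ τ ^ k * F τ)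
    (hb : F =O[atImInfty] fun _ ↦ (1 : ℂ)) : ∃ f : ModularForm 𝒮ℒ k, ⇑f = F := by
  have hs (γ : SL(2, ℤ)) : F ∣[k] γ = F := by
    ext τ
    rw [SL_slash_apply, hinv, zpow_neg]
    field_simp [zpow_ne_zero k (denom_ne_zero γ τ)]
  refine ⟨{ toFun := F, slash_action_eq' := ?_, holo' := hF, bdd_at_cusps' := ?_ }, rfl⟩
  · rintro _ ⟨γ, rfl⟩
    exact hs γ
  · intro c hc
    rw [Subgroup.IsArithmetic.isCusp_iff_isCusp_SL2Z] at hc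
    rw [OnePoint.isBoundedAt_iff_forall_SL2Z hc]
    intro γ _
    rw [hs]
    exact hb.norm_right.trans (isBigO_of_le _ fun _ ↦ by simp)

lemma smul_of_slash_eq {k : ℤ} {f : ℍ → ℂ} {γ : SL(2, ℤ)} (h : f ∣[k] γ = f) (τ : ℍ) :
    f (γ • τ) = denom γ τ ^ k * f τ := by
  have h := congrFun h τ
  rw [SL_slash_apply, zpow_neg] at h
  rw [← h]
  field_simp [zpow_ne_zero k (denom_ne_zero γ τ)]

lemma modularForm_smul {k : ℤ} (f : ModularForm 𝒮ℒ k) (γ : SL(2, ℤ)) (τ : ℍ) :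
    f (γ • τ) = denom γ τ ^ k * f τ :=
  smul_of_slash_eq (SlashInvariantFormClass.slash_action_eq f (γ : GL (Fin 2) ℝ) ⟨γ, rfl⟩) τ

lemma discriminant_smul (γ : SL(2, ℤ)) (τ : ℍ) :
    discriminant (γ • τ) = denom γ τ ^ 12 * discriminant τ :=
  smul_of_slash_eq (k := 12)
    (SlashInvariantForm.slash_action_generators_SL2Z discriminant_S_invariant
      discriminant_T_invariant γ) τ

lemma E₄_smul (γ : SL(2, ℤ)) (τ : ℍ) : E₄ (γ • τ) = denom γ τ ^ 4 * E₄ τ :=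
  mod_cast modularForm_smul E₄ γ τ

lemma E₆_smul (γ : SL(2, ℤ)) (τ : ℍ) : E₆ (γ • τ) = denom γ τ ^ 6 * E₆ τ :=
  mod_cast modularForm_smul E₆ γ τ

lemma jH_smul (γ : SL(2, ℤ)) (τ : ℍ) : jH (γ • τ) = jH τ := by
  rw [jH, jH, E₄_smul, discriminant_smul, mul_pow, ← pow_mul]
  exact mul_div_mul_left _ _ (pow_ne_zero _ (denom_ne_zero γ τ))

lemma mdiff_discriminant : MDiff discriminant := CuspForm.discriminant.holo'

lemma mdiff_E₄ : MDiff (fun τ ↦ E₄ τ) := ModularFormClass.holo E₄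
lemma mdiff_E₆ : MDiff (fun τ ↦ E₆ τ) := ModularFormClass.holo E₆

lemma mdiff_jH : MDiff jH :=
  (mdiff_E₄.pow 3).div mdiff_discriminant discriminant_ne_zero

lemma discriminant_isBigO_qp : discriminant =O[atImInfty] qp := by
  rw [← isBigO_norm_right]
  exact (CuspFormClass.exp_decay_atImInfty (h := 1) CuspForm.discriminant one_pos
    one_mem_strictPeriods_SL).congr_right fun τ ↦ by rw [norm_qp]; simp

lemma E₄_sub_one_isBigO : (fun τ ↦ E₄ τ - 1) =O[atImInfty] qp := by
  have h0 : (qExpansion 1 E₄).coeff 0 = 1 := by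
    rw [E_qExpansion_coeff _ (by decide)]; simp
  simpa [h0] using isBigO_qExpansion E₄ 1

open Polynomial in
/-- A holomorphic `SL₂(ℤ)`-invariant function with at most a pole at the cusp is a polynomial
in `j`. -/
lemma exists_polynomial (K : ℕ) (f : ℍ → ℂ) (hf : MDiff f)
    (hinv : ∀ (γ : SL(2, ℤ)) (τ : ℍ), f (γ • τ) = f τ)
    (hb : f =O[atImInfty] fun τ ↦ ((qp τ)⁻¹) ^ K) : ∃ p : ℂ[X], ∀ τ, f τ = p.eval (jH τ) := by
  induction K generalizing f with
  | zero =>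
    obtain ⟨g, hg⟩ := exists_modularForm (k := 0) hf (by simpa using hinv) (by simpa using hb)
    obtain ⟨c, hc⟩ := ModularFormClass.levelOne_weight_zero_const g
    exact ⟨C c, fun τ ↦ by simp [← hg, hc]⟩
  | succ K ih =>
    have hbd : (fun τ ↦ f τ * discriminant τ ^ (K + 1)) =O[atImInfty] fun _ ↦ (1 : ℂ) := by
      refine (hb.mul (discriminant_isBigO_qp.pow (K + 1))).congr_right fun τ ↦ ?_
      rw [← mul_pow, inv_mul_cancel₀ (qp_ne_zero τ), one_pow]
    obtain ⟨g, hg⟩ := exists_modularForm (k := 12 * (K + 1 : ℕ))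
      (hf.mul (mdiff_discriminant.pow (K + 1))) (fun γ τ ↦ by
        simp only [Pi.mul_apply, Pi.pow_apply, hinv, discriminant_smul]
        rw [zpow_mul, zpow_natCast, mul_pow]; norm_cast; ring) hbd
    set c := (qExpansion 1 g).coeff 0
    have h1 : (fun τ ↦ g τ - c) =O[atImInfty] qp := by
      simpa [c] using isBigO_qExpansion g 1
    have hT : Tendsto (fun τ ↦ E₄ τ) atImInfty (𝓝 1) :=
      tendsto_sub_nhds_zero_iff.mp (E₄_sub_one_isBigO.trans_tendsto tendsto_qp)
    have h3 : (fun τ ↦ (E₄ τ ^ 3) ^ (K + 1) - 1) =O[atImInfty] qp := by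
      have hb : (fun τ ↦ ∑ i ∈ Finset.range (3 * (K + 1)), E₄ τ ^ i)
          =O[atImInfty] fun _ ↦ (1 : ℂ) :=
        (tendsto_finsetSum _ fun i _ ↦ hT.pow i).isBigO_one ℂ
      refine (hb.mul E₄_sub_one_isBigO).congr (fun τ ↦ ?_) fun τ ↦ one_mul _
      rw [geom_sum_mul, pow_mul]
    have h4 : (fun τ ↦ f τ - c * jH τ ^ (K + 1)) =O[atImInfty] fun τ ↦ (qp τ)⁻¹ ^ K := by
      have hd : (fun τ ↦ (discriminant τ)⁻¹) =O[atImInfty] fun τ ↦ (qp τ)⁻¹ :=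
        qp_isBigO_discriminant.inv_rev (Eventually.of_forall fun τ h ↦ (qp_ne_zero τ h).elim)
      refine ((h1.sub (h3.const_mul_left c)).mul (hd.pow (K + 1))).congr (fun τ ↦ ?_) fun τ ↦ ?_
      · have := discriminant_ne_zero τ
        simp only [hg, Pi.mul_apply, Pi.pow_apply, jH, div_pow, inv_pow]
        field_simp
        ring
      · rw [pow_succ', ← mul_assoc, mul_inv_cancel₀ (qp_ne_zero τ), one_mul]
    obtain ⟨p, hp⟩ := ih (fun τ ↦ f τ - c * jH τ ^ (K + 1))
      (hf.sub (mdifferentiable_const.mul (mdiff_jH.pow (K + 1))))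
      (fun γ τ ↦ by simp only [hinv, jH_smul]) h4
    exact ⟨p + C c * X ^ (K + 1), fun τ ↦ by simp [← hp]⟩

lemma jH_mul_qp_tendsto : Tendsto (fun τ ↦ jH τ * qp τ) atImInfty (𝓝 1) := by
  have h1 : Tendsto (fun τ ↦ jH τ - (qp τ)⁻¹ - 744) atImInfty (𝓝 0) :=
    jH_isBigO.trans_tendsto tendsto_qp
  have h := ((h1.add_const 744).mul tendsto_qp).add_const 1
  simp only [zero_add, mul_zero] at h
  refine h.congr fun τ ↦ ?_
  have := qp_ne_zero τ
  field_simp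
  ring

lemma jH_sub_inv_tendsto (z : ℂ) : Tendsto (fun τ ↦ (jH τ - z)⁻¹) atImInfty (𝓝 0) := by
  have h1 : Tendsto (fun τ ↦ (jH τ - z) * qp τ) atImInfty (𝓝 1) := by
    simpa [sub_mul] using jH_mul_qp_tendsto.sub (tendsto_qp.const_mul z)
  have h := (h1.inv₀ one_ne_zero).mul tendsto_qp
  rw [mul_zero] at h
  refine h.congr fun τ ↦ ?_
  rw [mul_inv, mul_assoc, inv_mul_cancel₀ (qp_ne_zero τ), mul_one]

lemma exists_jH_eq (z : ℂ) : ∃ τ, jH τ = z := by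
  by_contra! hne
  have hne' (τ) : jH τ - z ≠ 0 := sub_ne_zero.mpr (hne τ)
  obtain ⟨g, hg⟩ := exists_modularForm (k := 0)
    ((mdiff_jH.sub mdifferentiable_const).inv hne')
      (fun γ τ ↦ by simp only [Pi.inv_apply, Pi.sub_apply, jH_smul, zpow_zero, one_mul])
    ((jH_sub_inv_tendsto z).isBigO_one ℂ)
  obtain ⟨c, hc⟩ := ModularFormClass.levelOne_weight_zero_const g
  have hc' (τ) : (jH τ - z)⁻¹ = c := by simpa using congrFun (hg.symm.trans hc) τ
  have h0 := jH_sub_inv_tendsto z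
  simp only [hc'] at h0
  have : c = 0 := tendsto_nhds_unique tendsto_const_nhds h0
  exact inv_ne_zero (hne' I) ((hc' I).trans this)

lemma normalizedDeriv_eq_cuspFunction {k : ℤ} (f : ModularForm 𝒮ℒ k) (τ : ℍ) :
    normalizedDerivOfComplex f τ = qp τ * deriv (cuspFunction 1 f) (qp τ) := by
  have hq : HasDerivAt (fun z : ℂ ↦ Function.Periodic.qParam 1 z)
      (qp τ * (2 * Real.pi * Complex.I)) (τ : ℂ) := by
    have h : HasDerivAt (fun z : ℂ ↦ 2 * Real.pi * Complex.I * z / (1 : ℝ))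
        (2 * Real.pi * Complex.I) (τ : ℂ) := by
      simpa using (hasDerivAt_id (τ : ℂ)).const_mul (2 * Real.pi * Complex.I : ℂ)
    exact h.cexp
  have hd : DifferentiableAt ℂ (cuspFunction 1 f) (qp τ) :=
    ModularFormClass.differentiableAt_cuspFunction f one_pos one_mem_strictPeriods_SL
      (by simpa using norm_qParam_lt_one 1 τ)
  have h := (hd.hasDerivAt.comp (τ : ℂ) hq).congr_of_eventuallyEq
    (f₁ := f ∘ ofComplex) (by
      filter_upwards [isOpen_upperHalfPlaneSet.mem_nhds τ.im_pos] with z hz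
      rw [Function.comp, Function.comp, ← eq_cuspFunction (ofComplex z) one_ne_zero
        (SlashInvariantFormClass.periodic_comp_ofComplex f one_mem_strictPeriods_SL),
        ofComplex_apply_of_im_pos hz])
  rw [normalizedDerivOfComplex, h.deriv]
  field_simp [Complex.two_pi_I_ne_zero]

lemma normalizedDeriv_div_tendsto {k : ℤ} (f : ModularForm 𝒮ℒ k) :
    Tendsto (fun τ ↦ normalizedDerivOfComplex f τ / qp τ) atImInfty
      (𝓝 ((qExpansion 1 f).coeff 1)) := by
  have ha := ModularFormClass.analyticAt_cuspFunction_zero f one_pos one_mem_strictPeriods_SL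
  have h := (ha.deriv.continuousAt.tendsto.comp tendsto_qp)
  have hc : (qExpansion 1 f).coeff 1 = deriv (cuspFunction 1 f) 0 := by
    simp [qExpansion, iteratedDeriv_one]
  rw [hc]
  refine h.congr fun τ ↦ ?_
  rw [normalizedDeriv_eq_cuspFunction, mul_div_cancel_left₀ _ (qp_ne_zero τ), Function.comp]

/-- The Rankin–Cohen bracket of `E₄` and `E₆`. -/
noncomputable def wronskian (τ : ℍ) : ℂ :=
  4 * E₄ τ * normalizedDerivOfComplex E₆ τ - 6 * E₆ τ * normalizedDerivOfComplex E₄ τ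

lemma wronskian_eq (τ : ℍ) : wronskian τ =
    4 * E₄ τ * serreDerivative 6 E₆ τ - 6 * E₆ τ * serreDerivative 4 E₄ τ := by
  simp only [wronskian, serreDerivative_apply]
  ring

lemma wronskian_smul (γ : SL(2, ℤ)) (τ : ℍ) :
    wronskian (γ • τ) = denom γ τ ^ 12 * wronskian τ := by
  have h4 := smul_of_slash_eq (serreDerivative_slash_invariant (k := 4) (γ := γ) mdiff_E₄
    (SlashInvariantFormClass.slash_action_eq E₄ (γ : GL (Fin 2) ℝ) ⟨γ, rfl⟩)) τ
  have h6 := smul_of_slash_eq (serreDerivative_slash_invariant (k := 6) (γ := γ) mdiff_E₆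
    (SlashInvariantFormClass.slash_action_eq E₆ (γ : GL (Fin 2) ℝ) ⟨γ, rfl⟩)) τ
  replace h4 : serreDerivative 4 E₄ (γ • τ) = denom γ τ ^ 6 * serreDerivative 4 E₄ τ := by
    exact_mod_cast h4
  replace h6 : serreDerivative 6 E₆ (γ • τ) = denom γ τ ^ 8 * serreDerivative 6 E₆ τ := by
    exact_mod_cast h6
  rw [wronskian_eq, wronskian_eq, E₄_smul, E₆_smul, h4, h6]
  ring

lemma mdiff_wronskian : MDiff wronskian :=
  ((mdifferentiable_const.mul mdiff_E₄).mul (normalizedDerivOfComplex_mdifferentiable mdiff_E₆)).sub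
    ((mdifferentiable_const.mul mdiff_E₆).mul (normalizedDerivOfComplex_mdifferentiable mdiff_E₄))

lemma E₆_sub_one_isBigO : (fun τ ↦ E₆ τ - 1) =O[atImInfty] qp := by
  have h0 : (qExpansion 1 E₆).coeff 0 = 1 := by
    rw [E_qExpansion_coeff _ (by decide)]; simp
  simpa [h0] using isBigO_qExpansion E₆ 1

lemma E₄_tendsto : Tendsto (fun τ ↦ E₄ τ) atImInfty (𝓝 1) :=
  tendsto_sub_nhds_zero_iff.mp (E₄_sub_one_isBigO.trans_tendsto tendsto_qp)

lemma E₆_tendsto : Tendsto (fun τ ↦ E₆ τ) atImInfty (𝓝 1) :=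
  tendsto_sub_nhds_zero_iff.mp (E₆_sub_one_isBigO.trans_tendsto tendsto_qp)

lemma wronskian_tendsto : Tendsto (fun τ ↦ wronskian τ / qp τ) atImInfty (𝓝 (-3456)) := by
  have h := (((E₄_tendsto.const_mul 4).mul (normalizedDeriv_div_tendsto E₆)).sub
    ((E₆_tendsto.const_mul 6).mul (normalizedDeriv_div_tendsto E₄)))
  rw [E₄_qExpansion_coeff_one, E₆_qExpansion_coeff_one] at h
  norm_num at h
  refine h.congr fun τ ↦ ?_
  rw [wronskian]
  ring

lemma wronskian_ne_zero (τ : ℍ) : wronskian τ ≠ 0 := by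
  have hO : wronskian =O[atImInfty] qp := by
    refine ((wronskian_tendsto.isBigO_one ℂ).mul (isBigO_refl qp _)).congr (fun τ ↦ ?_)
      fun τ ↦ one_mul _
    exact div_mul_cancel₀ _ (qp_ne_zero τ)
  have hb : (fun τ ↦ wronskian τ / discriminant τ) =O[atImInfty] fun _ ↦ (1 : ℂ) := by
    refine ((hO.trans qp_isBigO_discriminant).mul
      (isBigO_refl (fun τ ↦ (discriminant τ)⁻¹) _)).congr
      (fun τ ↦ rfl) fun τ ↦ mul_inv_cancel₀ (discriminant_ne_zero τ)
  obtain ⟨g, hg⟩ := exists_modularForm (k := 0)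
    (mdiff_wronskian.div mdiff_discriminant discriminant_ne_zero) (fun γ τ ↦ by
      simp only [Pi.div_apply, wronskian_smul, discriminant_smul, zpow_zero, one_mul]
      exact mul_div_mul_left _ _ (pow_ne_zero _ (denom_ne_zero γ τ))) hb
  obtain ⟨c, hc⟩ := ModularFormClass.levelOne_weight_zero_const g
  have hc' (τ) : wronskian τ = c * discriminant τ := by
    have := congrFun (hg.symm.trans hc) τ
    rwa [Pi.div_apply, Function.const_apply, div_eq_iff (discriminant_ne_zero τ)] at this
  intro h0
  have : c = 0 := by simpa [hc', discriminant_ne_zero] using h0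
  have h := wronskian_tendsto
  simp only [hc', this, zero_mul, zero_div] at h
  have := tendsto_nhds_unique h tendsto_const_nhds
  norm_num at this

/-- Order of vanishing of a function on the upper half plane. -/
noncomputable def ordH (f : ℍ → ℂ) (τ : ℍ) : ℕ∞ := analyticOrderAt (f ∘ ofComplex) τ

lemma analyticAt_of_mdiff {f : ℍ → ℂ} (hf : MDiff f) (τ : ℍ) :
    AnalyticAt ℂ (f ∘ ofComplex) τ :=
  (UpperHalfPlane.mdifferentiable_iff.mp hf).analyticAt
    (isOpen_upperHalfPlaneSet.mem_nhds τ.im_pos)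

lemma ordH_mul {f g : ℍ → ℂ} (hf : MDiff f) (hg : MDiff g) (τ : ℍ) :
    ordH (fun τ ↦ f τ * g τ) τ = ordH f τ + ordH g τ :=
  analyticOrderAt_mul (analyticAt_of_mdiff hf τ) (analyticAt_of_mdiff hg τ)

lemma ordH_pow {f : ℍ → ℂ} (hf : MDiff f) (n : ℕ) (τ : ℍ) :
    ordH (fun τ ↦ f τ ^ n) τ = n * ordH f τ := by
  rw [← nsmul_eq_mul]
  exact analyticOrderAt_pow (analyticAt_of_mdiff hf τ) n

lemma ordH_eq_zero {f : ℍ → ℂ} (hf : MDiff f) {τ : ℍ} (h : f τ ≠ 0) : ordH f τ = 0 :=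
  (analyticAt_of_mdiff hf τ).analyticOrderAt_eq_zero.mpr (by simpa using h)

lemma ordH_div {f g : ℍ → ℂ} (hf : MDiff f) (hg : MDiff g) (h : ∀ τ, g τ ≠ 0) (τ : ℍ) :
    ordH (fun τ ↦ f τ / g τ) τ = ordH f τ := by
  have h1 := ordH_mul hf (hg.inv h) τ
  rw [ordH_eq_zero (hg.inv h) (by simpa using h τ), add_zero] at h1
  exact h1

lemma ordH_eq_one {f : ℍ → ℂ} (hf : MDiff f) {τ : ℍ} (h0 : f τ = 0)
    (h : normalizedDerivOfComplex f τ ≠ 0) : ordH f τ = 1 :=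
  (analyticAt_of_mdiff hf τ).analyticOrderAt_eq_one_of_zero_deriv_ne_zero (by simpa using h0)
    (right_ne_zero_of_mul h)

/-- The ramification index of `j` over `z`. -/
noncomputable def ramif (z : ℂ) : ℕ := if z = 0 then 3 else if z = 1728 then 2 else 1

lemma jH_eq_zero_iff (τ : ℍ) : jH τ = 0 ↔ E₄ τ = 0 := by
  simp [jH, discriminant_ne_zero]

lemma jH_eq_1728_iff (τ : ℍ) : jH τ = 1728 ↔ E₆ τ = 0 := by
  rw [← sub_eq_zero, jH_sub_1728]
  simp [discriminant_ne_zero]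

lemma normalizedDeriv_jH (τ : ℍ) : normalizedDerivOfComplex jH τ =
    E₄ τ ^ 2 * E₆ τ * wronskian τ / (3456 * discriminant τ ^ 2) := by
  have hΔ : normalizedDerivOfComplex discriminant τ = (3 * E₄ τ ^ 2 * normalizedDerivOfComplex E₄ τ
      - 2 * E₆ τ * normalizedDerivOfComplex E₆ τ) / 1728 := by
    have : discriminant = (1728 : ℂ)⁻¹ • ((fun τ ↦ E₄ τ) ^ 3 - (fun τ ↦ E₆ τ) ^ 2) := by
      ext τ
      simp [discriminant_eq_E₄_cube_sub_E₆_sq]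
      ring
    rw [this, normalizedDerivOfComplex_smul _ _ ((mdiff_E₄.pow 3).sub (mdiff_E₆.pow 2)),
      normalizedDerivOfComplex_sub _ _ (mdiff_E₄.pow 3) (mdiff_E₆.pow 2),
      normalizedDerivOfComplex_pow _ _ mdiff_E₄, normalizedDerivOfComplex_pow _ _ mdiff_E₆]
    simp
    ring
  have h3 : (fun τ ↦ E₄ τ) ^ 3 = jH * discriminant := by
    ext τ
    simp [jH, discriminant_ne_zero]
  have h := congrFun (congrArg normalizedDerivOfComplex h3) τ
  rw [normalizedDerivOfComplex_pow _ _ mdiff_E₄,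
    normalizedDerivOfComplex_mul _ _ mdiff_jH mdiff_discriminant] at h
  simp only [Pi.mul_apply, Pi.add_apply, Pi.pow_apply, hΔ, jH, Nat.cast_ofNat, Pi.ofNat_apply] at h
  have hD := discriminant_ne_zero τ
  have hD' := discriminant_eq_E₄_cube_sub_E₆_sq τ
  have h4 : normalizedDerivOfComplex jH τ = (3 * E₄ τ ^ 2 * normalizedDerivOfComplex E₄ τ
      - E₄ τ ^ 3 / discriminant τ * ((3 * E₄ τ ^ 2 * normalizedDerivOfComplex E₄ τ
      - 2 * E₆ τ * normalizedDerivOfComplex E₆ τ) / 1728)) / discriminant τ := by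
    rw [eq_div_iff hD]
    linear_combination -h
  rw [h4, wronskian]
  field_simp
  rw [hD']
  ring

lemma ordH_jH_sub (τ : ℍ) : ordH (fun τ' ↦ jH τ' - jH τ) τ = ramif (jH τ) := by
  have hw := wronskian_ne_zero τ
  rw [ramif]
  split_ifs with h0 h1
  · rw [h0]
    rw [jH_eq_zero_iff] at h0
    have hD : normalizedDerivOfComplex E₄ τ ≠ 0 := by
      intro h; simp [wronskian, h0, h] at hw
    have h := ordH_div (mdiff_E₄.pow 3) mdiff_discriminant discriminant_ne_zero τ
    have h2 := ordH_pow mdiff_E₄ 3 τ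
    rw [ordH_eq_one mdiff_E₄ h0 hD] at h2
    simp only [sub_zero]
    exact (h.trans h2).trans (by simp)
  · rw [h1]
    rw [jH_eq_1728_iff] at h1
    have hD : normalizedDerivOfComplex E₆ τ ≠ 0 := by
      intro h; simp [wronskian, h1, h] at hw
    have h := ordH_div (mdiff_E₆.pow 2) mdiff_discriminant discriminant_ne_zero τ
    have h2 := ordH_pow mdiff_E₆ 2 τ
    rw [ordH_eq_one mdiff_E₆ h1 hD] at h2
    simp only [jH_sub_1728]
    exact (h.trans h2).trans (by simp)
  · have hne : normalizedDerivOfComplex jH τ ≠ 0 := by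
      rw [normalizedDeriv_jH]
      exact div_ne_zero (mul_ne_zero (mul_ne_zero (pow_ne_zero _ ((jH_eq_zero_iff τ).not.mp h0))
        ((jH_eq_1728_iff τ).not.mp h1)) hw)
        (mul_ne_zero (by norm_num) (pow_ne_zero _ (discriminant_ne_zero τ)))
    refine ordH_eq_one (mdiff_jH.sub mdifferentiable_const) (by simp) ?_
    rw [normalizedDerivOfComplex_sub _ _ mdiff_jH mdifferentiable_const]
    simpa using hne

lemma weierstrass_ode (L : PeriodPair) : ∀ᶠ z in 𝓝[≠] (0 : ℂ),
    (z ^ 3 * deriv (L.weierstrassPExcept 0) z - 2) ^ 2 =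
      4 * (z ^ 2 * L.weierstrassPExcept 0 z + 1) ^ 3
      - L.g₂ * z ^ 4 * (z ^ 2 * L.weierstrassPExcept 0 z + 1) - L.g₃ * z ^ 6 := by
  have h1 := nhdsWithin_le_nhds (s := ({0}ᶜ : Set ℂ)) (L.compl_lattice_sdiff_singleton_mem_nhds 0)
  filter_upwards [h1, self_mem_nhdsWithin] with z hz hz0
  have hz0 : z ≠ 0 := hz0
  have hzL : z ∉ L.lattice := fun h ↦ hz ⟨h, hz0⟩
  have hadd (y : ℂ) : L.weierstrassP y = L.weierstrassPExcept 0 y + 1 / y ^ 2 := by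
    have := L.weierstrassPExcept_add 0 y
    simpa using this.symm
  have hd : L.derivWeierstrassP z = deriv (L.weierstrassPExcept 0) z - 2 / z ^ 3 := by
    rw [← L.deriv_weierstrassP,
      show L.weierstrassP = fun y ↦ L.weierstrassPExcept 0 y + 1 / y ^ 2 from funext hadd]
    have h2 : DifferentiableAt ℂ (L.weierstrassPExcept 0) z :=
      (L.differentiableOn_weierstrassPExcept 0).differentiableAt
        (L.isOpen_compl_lattice_sdiff.mem_nhds hz)
    have h3 : HasDerivAt (fun y : ℂ ↦ 1 / y ^ 2) (-2 / z ^ 3) z := by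
      simp only [one_div]
      refine ((hasDerivAt_pow 2 z).inv (pow_ne_zero 2 hz0)).congr_deriv ?_
      norm_num
      field_simp
    rw [(h2.hasDerivAt.fun_add h3).deriv]
    ring
  have h := L.derivWeierstrassP_sq z hzL
  rw [hd, hadd] at h
  have e : (z ^ 3 * deriv (L.weierstrassPExcept 0) z - 2) ^ 2
      = z ^ 6 * (deriv (L.weierstrassPExcept 0) z - 2 / z ^ 3) ^ 2 := by
    field_simp
  rw [e, h]
  field_simp

lemma weierstrassPExcept_eventuallyEq {L M : PeriodPair} (h₂ : L.g₂ = M.g₂) (h₃ : L.g₃ = M.g₃) :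
    ∀ᶠ z in 𝓝 (0 : ℂ), L.weierstrassPExcept 0 z = M.weierstrassPExcept 0 z := by
  set v := L.weierstrassPExcept 0
  set u := M.weierstrassPExcept 0
  have hv : AnalyticAt ℂ v 0 := L.analyticAt_weierstrassPExcept 0
  have hu : AnalyticAt ℂ u 0 := M.analyticAt_weierstrassPExcept 0
  suffices h : analyticOrderAt (v - u) 0 = ⊤ by
    filter_upwards [analyticOrderAt_eq_top.mp h] with z hz using sub_eq_zero.mp hz
  by_contra htop
  obtain ⟨m, hm⟩ := ENat.ne_top_iff_exists.mp htop
  obtain ⟨g, hg, hg0, hgm⟩ := (hv.sub hu).analyticOrderAt_eq_natCast.mp hm.symm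
  have hm0 : m ≠ 0 := by
    rintro rfl
    have := hgm.self_of_nhds
    simp [v, u] at this
    exact hg0 this.symm
  have hid : ∀ᶠ z in 𝓝[≠] (0 : ℂ), (m * g z + z * deriv g z) *
      (z ^ 3 * (deriv v z + deriv u z) - 4) = g z * (4 * ((z ^ 2 * v z + 1) ^ 2 +
        (z ^ 2 * v z + 1) * (z ^ 2 * u z + 1) + (z ^ 2 * u z + 1) ^ 2) - L.g₂ * z ^ 4) := by
    filter_upwards [weierstrass_ode L, weierstrass_ode M, self_mem_nhdsWithin,
      nhdsWithin_le_nhds hgm.eventually_nhds, nhdsWithin_le_nhds hv.eventually_analyticAt,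
      nhdsWithin_le_nhds hu.eventually_analyticAt, nhdsWithin_le_nhds hg.eventually_analyticAt]
      with z hL hM hz hgz hvz huz hgz'
    have hz : z ≠ 0 := hz
    have hw : v z - u z = z ^ m * g z := by simpa using hgz.self_of_nhds
    have hd : deriv v z - deriv u z = m * z ^ (m - 1) * g z + z ^ m * deriv g z := by
      rw [← deriv_sub hvz.differentiableAt huz.differentiableAt, Filter.EventuallyEq.deriv_eq hgz]
      simp only [sub_zero, smul_eq_mul]
      exact ((hasDerivAt_pow m z).mul hgz'.differentiableAt.hasDerivAt).deriv
    have hzm : z * z ^ (m - 1) = z ^ m := by rw [← pow_succ', Nat.sub_add_cancel (by lia)]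
    have hd' : z * (deriv v z - deriv u z) = z ^ m * (m * g z + z * deriv g z) := by
      rw [hd, ← hzm]; ring
    change (z ^ 3 * deriv v z - 2) ^ 2 = 4 * (z ^ 2 * v z + 1) ^ 3 -
      L.g₂ * z ^ 4 * (z ^ 2 * v z + 1) - L.g₃ * z ^ 6 at hL
    change (z ^ 3 * deriv u z - 2) ^ 2 = 4 * (z ^ 2 * u z + 1) ^ 3 -
      M.g₂ * z ^ 4 * (z ^ 2 * u z + 1) - M.g₃ * z ^ 6 at hM
    rw [← h₂, ← h₃] at hM
    refine mul_left_cancel₀ (mul_ne_zero (pow_ne_zero 2 hz) (pow_ne_zero m hz)) ?_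
    linear_combination hL - hM - z ^ 2 * (z ^ 3 * (deriv v z + deriv u z) - 4) * hd' +
      z ^ 2 * (4 * ((z ^ 2 * v z + 1) ^ 2 +
        (z ^ 2 * v z + 1) * (z ^ 2 * u z + 1) + (z ^ 2 * u z + 1) ^ 2) - L.g₂ * z ^ 4) * hw
  have c1 : ContinuousAt g 0 := hg.continuousAt
  have c2 : ContinuousAt (deriv g) 0 := hg.deriv.continuousAt
  have c3 : ContinuousAt v 0 := hv.continuousAt
  have c4 : ContinuousAt u 0 := hu.continuousAt
  have c5 : ContinuousAt (deriv v) 0 := hv.deriv.continuousAt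
  have c6 : ContinuousAt (deriv u) 0 := hu.deriv.continuousAt
  have hlim := tendsto_nhds_unique_of_eventuallyEq
    (ContinuousAt.tendsto (x := (0 : ℂ)) (f := fun z ↦ (m * g z + z * deriv g z) *
      (z ^ 3 * (deriv v z + deriv u z) - 4)) (by fun_prop) |>.mono_left nhdsWithin_le_nhds)
    (ContinuousAt.tendsto (x := (0 : ℂ)) (f := fun z ↦ g z * (4 * ((z ^ 2 * v z + 1) ^ 2 +
        (z ^ 2 * v z + 1) * (z ^ 2 * u z + 1) + (z ^ 2 * u z + 1) ^ 2) - L.g₂ * z ^ 4))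
        (by fun_prop) |>.mono_left nhdsWithin_le_nhds) hid
  norm_num at hlim
  have h5 : (m : ℂ) + 3 = 0 := by
    refine mul_left_cancel₀ hg0 ?_
    linear_combination -hlim / 4
  norm_cast at h5

lemma PeriodPair_lattice_eq {L M : PeriodPair} (h₂ : L.g₂ = M.g₂) (h₃ : L.g₃ = M.g₃) :
    L.lattice = M.lattice := by
  have hL (y : ℂ) : L.weierstrassP y = L.weierstrassPExcept 0 y + 1 / y ^ 2 := by
    simpa using (L.weierstrassPExcept_add 0 y).symm
  have hM (y : ℂ) : M.weierstrassP y = M.weierstrassPExcept 0 y + 1 / y ^ 2 := by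
    simpa using (M.weierstrassPExcept_add 0 y).symm
  have hmer : MeromorphicOn (L.weierstrassP - M.weierstrassP) Set.univ := fun z _ ↦
    (L.meromorphic_weierstrassP z).sub (M.meromorphic_weierstrassP z)
  have h0 : meromorphicOrderAt (L.weierstrassP - M.weierstrassP) 0 = ⊤ := by
    rw [meromorphicOrderAt_eq_top_iff]
    refine nhdsWithin_le_nhds ?_
    filter_upwards [weierstrassPExcept_eventuallyEq h₂ h₃] with z hz
    simp [hL, hM, hz]
  have hall (z : ℂ) : meromorphicOrderAt (L.weierstrassP - M.weierstrassP) z = ⊤ := by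
    by_contra h
    exact hmer.meromorphicOrderAt_ne_top_of_isPreconnected isPreconnected_univ
      (Set.mem_univ z) (Set.mem_univ 0) h h0
  have hev (z : ℂ) : L.weierstrassP =ᶠ[𝓝[≠] z] M.weierstrassP := by
    filter_upwards [meromorphicOrderAt_eq_top_iff.mp (hall z)] with w hw using sub_eq_zero.mp hw
  ext z
  constructor
  · intro hz
    by_contra hz'
    have h := L.order_weierstrassP z hz
    rw [meromorphicOrderAt_congr (hev z)] at h
    have := (M.analyticOnNhd_weierstrassP z hz').meromorphicOrderAt_nonneg
    rw [h] at this
    exact absurd this (by decide)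
  · intro hz
    by_contra hz'
    have h := M.order_weierstrassP z hz
    rw [← meromorphicOrderAt_congr (hev z)] at h
    have := (L.analyticOnNhd_weierstrassP z hz').meromorphicOrderAt_nonneg
    rw [h] at this
    exact absurd this (by decide)

/-- The pair of periods `(ω τ, ω)`. -/
noncomputable def scaledPair (τ : ℍ) {ω : ℂ} (hω : ω ≠ 0) : PeriodPair where
  ω₁ := ω * τ
  ω₂ := ω
  indep := by
    rw [LinearIndependent.pair_iff]
    intro s t h
    have h1 : (s : ℂ) * τ + t = 0 := by
      refine mul_left_cancel₀ hω ?_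
      simp only [Complex.real_smul] at h
      linear_combination h
    have h2 := congrArg Complex.im h1
    have h3 := congrArg Complex.re h1
    simp at h2 h3
    have hs : s = 0 := h2.resolve_right τ.im_ne_zero
    subst hs
    exact ⟨rfl, by simpa using h3⟩

lemma scaledPair_G (τ : ℍ) {ω : ℂ} (hω : ω ≠ 0) {k : ℕ} (hk : k ≠ 0) :
    (scaledPair τ hω).G k = latticeG k τ / ω ^ k := by
  rw [PeriodPair.G, ← (scaledPair τ hω).latticeEquivProd.symm.toEquiv.tsum_eq, latticeG,
    ← tsum_div_const]
  refine tsum_congr fun p ↦ ?_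
  have := (scaledPair τ hω).latticeEquiv_symm_apply p
  change ((((scaledPair τ hω).latticeEquivProd.symm p).1) ^ k)⁻¹ = _
  rw [show ((scaledPair τ hω).latticeEquivProd.symm p).1 = ω * (p.1 * τ + p.2) from
    this.trans (by simp only [scaledPair]; ring)]
  split_ifs with h
  · simp [h, hk]
  · rw [mul_pow, mul_inv, one_div, div_eq_mul_inv, mul_comm]

lemma exists_smul_eq_of_lattice {τ τ' : ℍ} {ω : ℂ} (hω : ω ≠ 0)
    (h : (scaledPair τ hω).lattice = (scaledPair τ' one_ne_zero).lattice) :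
    ∃ γ : SL(2, ℤ), γ • τ = τ' := by
  have hli {τ : ℍ} {s t : ℤ} (h : (s : ℂ) * τ + t = 0) : s = 0 ∧ t = 0 := by
    have h2 := congrArg Complex.im h
    have h3 := congrArg Complex.re h
    simp at h2 h3
    have hs : s = 0 := h2.resolve_right τ.im_ne_zero
    subst hs
    exact ⟨rfl, by simpa using h3⟩
  obtain ⟨a, b, h1⟩ := PeriodPair.mem_lattice.mp (h ▸ (scaledPair τ' one_ne_zero).ω₁_mem_lattice)
  obtain ⟨c, d, h2⟩ := PeriodPair.mem_lattice.mp (h ▸ (scaledPair τ' one_ne_zero).ω₂_mem_lattice)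
  obtain ⟨p, q, h3⟩ := PeriodPair.mem_lattice.mp (h ▸ (scaledPair τ hω).ω₁_mem_lattice)
  obtain ⟨r, s, h4⟩ := PeriodPair.mem_lattice.mp (h ▸ (scaledPair τ hω).ω₂_mem_lattice)
  simp only [scaledPair, one_mul] at h1 h2 h3 h4
  have e1 := hli (τ := τ') (s := a * p + b * r - 1) (t := a * q + b * s) (by
    push_cast; linear_combination h1 + a * h3 + b * h4)
  have e2 := hli (τ := τ') (s := c * p + d * r) (t := c * q + d * s - 1) (by
    push_cast; linear_combination h2 + c * h3 + d * h4)
  have hdet : (a * d - b * c) * (p * s - q * r) = 1 := by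
    linear_combination (c * q + d * s) * e1.1 + e2.2 - (c * p + d * r) * e1.2
  have hne : (c : ℂ) * τ + d ≠ 0 := fun h0 ↦ one_ne_zero (α := ℂ) (by
    linear_combination -h2 + ω * h0)
  have hτ' : (τ' : ℂ) = (a * τ + b) / (c * τ + d) := by
    rw [eq_div_iff hne]
    refine mul_left_cancel₀ hω ?_
    linear_combination -h1 + τ' * h2
  have him : τ'.im * Complex.normSq (c * τ + d) = (a * d - b * c : ℤ) * τ.im := by
    have hn : Complex.normSq (c * τ + d) ≠ 0 := (Complex.normSq_pos.mpr hne).ne'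
    rw [← UpperHalfPlane.coe_im τ', hτ', Complex.div_im]
    generalize Complex.normSq (c * τ + d) = N at hn ⊢
    field_simp
    simp
    ring
  have hpos : 0 < a * d - b * c := by
    have h5 : 0 < ((a * d - b * c : ℤ) : ℝ) * τ.im := by
      rw [← him]; exact mul_pos τ'.im_pos (Complex.normSq_pos.mpr hne)
    exact_mod_cast pos_of_mul_pos_left h5 τ.im_pos.le
  have hone : a * d - b * c = 1 := by
    rcases Int.isUnit_iff.mp (IsUnit.of_mul_eq_one _ hdet) with h | h <;> lia
  let γ : SL(2, ℤ) := ⟨!![a, b; c, d], by rw [Matrix.det_fin_two_of]; exact hone⟩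
  refine ⟨γ, UpperHalfPlane.ext ?_⟩
  rw [hτ', UpperHalfPlane.coe_specialLinearGroup_apply]
  simp [γ]

/-- The `j`-invariant separates orbits of the modular group. -/
lemma exists_smul_eq_of_jH_eq {τ τ' : ℍ} (h : jH τ = jH τ') : ∃ γ : SL(2, ℤ), γ • τ = τ' := by
  have hD := discriminant_ne_zero τ
  have hD' := discriminant_ne_zero τ'
  have h1 : E₄ τ ^ 3 * discriminant τ' = E₄ τ' ^ 3 * discriminant τ := by
    rw [jH, jH, div_eq_div_iff hD hD'] at h; exact h
  have h2 : E₆ τ ^ 2 * discriminant τ' = E₆ τ' ^ 2 * discriminant τ := by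
    have : jH τ - 1728 = jH τ' - 1728 := by rw [h]
    rw [jH_sub_1728, jH_sub_1728, div_eq_div_iff hD hD'] at this; exact this
  obtain ⟨ω, hω, e4, e6⟩ : ∃ ω : ℂ, ω ≠ 0 ∧ E₄ τ = ω ^ 4 * E₄ τ' ∧ E₆ τ = ω ^ 6 * E₆ τ' := by
    by_cases h4 : E₄ τ' = 0
    · have h4' : E₄ τ = 0 := by simpa [h4, hD'] using h1
      have h6 : E₆ τ' ≠ 0 := fun h6 ↦ hD' (by rw [discriminant_eq_E₄_cube_sub_E₆_sq]; simp [h4, h6])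
      have h6' : E₆ τ ≠ 0 := fun h6 ↦ hD (by rw [discriminant_eq_E₄_cube_sub_E₆_sq]; simp [h4', h6])
      obtain ⟨ω, hω⟩ := IsAlgClosed.exists_pow_nat_eq (E₆ τ / E₆ τ') (n := 6) (by norm_num)
      refine ⟨ω, ?_, by simp [h4, h4'], by rw [hω]; field_simp⟩
      rintro rfl
      exact div_ne_zero h6' h6 (by simpa using hω.symm)
    · have h4' : E₄ τ ≠ 0 := fun h0 ↦ h4 (by simpa [h0, hD] using h1)
      by_cases h6 : E₆ τ' = 0
      · have h6' : E₆ τ = 0 := by simpa [h6, hD'] using h2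
        obtain ⟨ω, hω⟩ := IsAlgClosed.exists_pow_nat_eq (E₄ τ / E₄ τ') (n := 4) (by norm_num)
        refine ⟨ω, ?_, by rw [hω]; field_simp, by simp [h6, h6']⟩
        rintro rfl
        exact div_ne_zero h4' h4 (by simpa using hω.symm)
      · have h6' : E₆ τ ≠ 0 := fun h0 ↦ h6 (by simpa [h0, hD] using h2)
        obtain ⟨ω, hω⟩ := IsAlgClosed.exists_pow_nat_eq ((E₆ τ / E₆ τ') / (E₄ τ / E₄ τ'))
          (n := 2) (by norm_num)
        have h3 : E₄ τ ^ 3 * E₆ τ' ^ 2 = E₄ τ' ^ 3 * E₆ τ ^ 2 := by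
          refine mul_right_cancel₀ hD' (mul_right_cancel₀ hD ?_)
          linear_combination E₆ τ' ^ 2 * discriminant τ * h1 - E₄ τ' ^ 3 * discriminant τ * h2
        refine ⟨ω, ?_, ?_, ?_⟩
        · rintro rfl
          refine div_ne_zero (div_ne_zero h6' h6) (div_ne_zero h4' h4) (by rw [← hω]; norm_num)
        · rw [show ω ^ 4 = (ω ^ 2) ^ 2 by ring, hω]
          field_simp
          linear_combination h3
        · rw [show ω ^ 6 = (ω ^ 2) ^ 3 by ring, hω]
          field_simp
          linear_combination h3
  refine exists_smul_eq_of_lattice hω (PeriodPair_lattice_eq ?_ ?_)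
  · rw [PeriodPair.g₂, PeriodPair.g₂, scaledPair_G _ _ (by norm_num),
      scaledPair_G _ _ (by norm_num), latticeG_eq 4 (by norm_num), latticeG_eq 4 (by norm_num)]
    change 60 * (2 * _ * E₄ τ / _) = 60 * (2 * _ * E₄ τ' / _)
    rw [e4]
    field_simp
  · rw [PeriodPair.g₃, PeriodPair.g₃, scaledPair_G _ _ (by norm_num),
      scaledPair_G _ _ (by norm_num), latticeG_eq 6 (by norm_num), latticeG_eq 6 (by norm_num)]
    change 140 * (2 * _ * E₆ τ / _) = 140 * (2 * _ * E₆ τ' / _)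
    rw [e6]
    field_simp

/-- The Möbius transformation attached to an integral matrix of positive determinant. -/
noncomputable def mob (A : Matrix (Fin 2) (Fin 2) ℤ) : GL (Fin 2) ℝ :=
  if h : (A.map (Int.cast : ℤ → ℝ)).det ≠ 0 then Matrix.GeneralLinearGroup.mkOfDetNeZero _ h else 1

lemma det_map_intCast (A : Matrix (Fin 2) (Fin 2) ℤ) :
    (A.map (Int.cast : ℤ → ℝ)).det = (A.det : ℝ) := by
  simp [Matrix.det_fin_two]

lemma mob_val {A : Matrix (Fin 2) (Fin 2) ℤ} (h : 0 < A.det) :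
    (mob A).val = A.map (Int.cast : ℤ → ℝ) := by
  rw [mob, dif_pos (by rw [det_map_intCast]; exact_mod_cast h.ne')]
  rfl

lemma mob_det_pos {A : Matrix (Fin 2) (Fin 2) ℤ} (h : 0 < A.det) : 0 < (mob A).det.val := by
  rw [Matrix.GeneralLinearGroup.val_det_apply, mob_val h, det_map_intCast]
  exact_mod_cast h

lemma coe_mob_smul {A : Matrix (Fin 2) (Fin 2) ℤ} (h : 0 < A.det) (τ : ℍ) :
    ((mob A • τ : ℍ) : ℂ) = (A 0 0 * τ + A 0 1) / (A 1 0 * τ + A 1 1) := by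
  rw [UpperHalfPlane.coe_smul_of_det_pos (mob_det_pos h)]
  simp [num, denom, mob_val h]

lemma mob_denom_ne_zero {A : Matrix (Fin 2) (Fin 2) ℤ} (h : 0 < A.det) (τ : ℍ) :
    (A 1 0 * τ + A 1 1 : ℂ) ≠ 0 := by
  have := UpperHalfPlane.denom_ne_zero (mob A) τ
  simpa [denom, mob_val h] using this

lemma mob_mul_smul {A B : Matrix (Fin 2) (Fin 2) ℤ} (hA : 0 < A.det) (hB : 0 < B.det) (τ : ℍ) :
    mob (A * B) • τ = mob A • mob B • τ := by
  rw [← mul_smul]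
  congr 1
  refine Units.ext ?_
  rw [mob_val (by rw [Matrix.det_mul]; positivity), Units.val_mul, mob_val hA, mob_val hB]
  exact Matrix.map_mul (f := Int.castRingHom ℝ)

lemma mob_coe_smul (γ : SL(2, ℤ)) (τ : ℍ) : mob γ.1 • τ = γ • τ := by
  refine UpperHalfPlane.ext ?_
  rw [coe_mob_smul (by rw [γ.2]; norm_num), UpperHalfPlane.coe_specialLinearGroup_apply]
  simp

lemma mob_smul_eq_self_iff {A : Matrix (Fin 2) (Fin 2) ℤ} (h : 0 < A.det) (τ : ℍ) :
    mob A • τ = τ ↔ (A 0 0 * τ + A 0 1 : ℂ) = τ * (A 1 0 * τ + A 1 1) := by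
  rw [UpperHalfPlane.ext_iff, coe_mob_smul h, div_eq_iff (mob_denom_ne_zero h τ)]

lemma smul_eq_self_iff (γ : SL(2, ℤ)) (τ : ℍ) :
    γ • τ = τ ↔ (γ 0 0 * τ + γ 0 1 : ℂ) = τ * (γ 1 0 * τ + γ 1 1) := by
  rw [← mob_coe_smul, mob_smul_eq_self_iff (by rw [γ.2]; norm_num)]

lemma int_mul_add_eq_zero {τ : ℍ} {s t : ℤ} (h : (s : ℂ) * τ + t = 0) : s = 0 ∧ t = 0 := by
  have h2 := congrArg Complex.im h
  have h3 := congrArg Complex.re h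
  simp at h2 h3
  have hs : s = 0 := h2.resolve_right τ.im_ne_zero
  subst hs
  exact ⟨rfl, by simpa using h3⟩

/-- The point `ρ = (-1 + √-3) / 2`. -/
noncomputable def rho : ℍ := ⟨⟨-1 / 2, √3 / 2⟩, by simp⟩

lemma rho_sq : (rho : ℂ) ^ 2 = -1 - rho := by
  have : (√3 : ℝ) ^ 2 = 3 := Real.sq_sqrt (by norm_num)
  apply Complex.ext <;> simp [rho, pow_two] <;> nlinarith

lemma I_sq' : ((UpperHalfPlane.I : ℍ) : ℂ) ^ 2 = -1 := by
  simp

lemma S_smul_I : ModularGroup.S • UpperHalfPlane.I = UpperHalfPlane.I := by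
  rw [smul_eq_self_iff]
  simp [ModularGroup.S]

/-- An element of order six fixing `ρ`. -/
def rhoStab : SL(2, ℤ) := ⟨!![0, -1; 1, 1], by simp⟩

lemma rho_smul : rhoStab • rho = rho := by
  rw [smul_eq_self_iff]
  simp [rhoStab]
  linear_combination -rho_sq

lemma denom_coe (γ : SL(2, ℤ)) (τ : ℍ) : denom γ τ = γ 1 0 * τ + γ 1 1 := by
  simp [denom]

lemma jH_I : jH UpperHalfPlane.I = 1728 := by
  rw [jH_eq_1728_iff]
  have h := E₆_smul ModularGroup.S UpperHalfPlane.I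
  rw [S_smul_I, denom_coe] at h
  simp [ModularGroup.S, show Complex.I ^ 6 = -1 by
    rw [show 6 = 2 * 3 by rfl, pow_mul]; simp; norm_num] at h
  linear_combination h / 2

lemma rho_ne_intCast (k : ℤ) : (rho : ℂ) ≠ k := fun h ↦ by
  have := congrArg Complex.im h
  simp [rho] at this

lemma jH_rho : jH rho = 0 := by
  rw [jH_eq_zero_iff]
  have h := E₄_smul rhoStab rho
  rw [rho_smul, denom_coe] at h
  simp only [rhoStab] at h
  simp at h
  have h1 : (2 + (rho : ℂ)) * E₄ rho = 0 := by
    linear_combination h + (rho ^ 2 + 3 * (rho : ℂ) + 2) * E₄ rho * rho_sq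
  refine (mul_eq_zero.mp h1).resolve_left fun h0 ↦ rho_ne_intCast (-2) ?_
  push_cast
  linear_combination h0

lemma eq_of_bottom_eq {γ δ : SL(2, ℤ)} {τ : ℍ} (hγ : γ • τ = τ) (hδ : δ • τ = τ)
    (h0 : γ 1 0 = δ 1 0) (h1 : γ 1 1 = δ 1 1) : γ = δ := by
  rw [smul_eq_self_iff] at hγ hδ
  have h := int_mul_add_eq_zero (τ := τ) (s := γ 0 0 - δ 0 0) (t := γ 0 1 - δ 0 1) (by
    push_cast
    rw [h0, h1] at hγ
    linear_combination hγ - hδ)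
  ext i j
  fin_cases i <;> fin_cases j
  · exact sub_eq_zero.mp h.1
  · exact sub_eq_zero.mp h.2
  · exact h0
  · exact h1

lemma stabilizer_eq_of_jH_ne {τ : ℍ} (h0 : jH τ ≠ 0) (h1 : jH τ ≠ 1728) :
    (MulAction.stabilizer SL(2, ℤ) τ : Set SL(2, ℤ)) = {1, -1} := by
  have h4 : E₄ τ ≠ 0 := mt (jH_eq_zero_iff τ).mpr h0
  have h6 : E₆ τ ≠ 0 := mt (jH_eq_1728_iff τ).mpr h1
  ext γ
  simp only [SetLike.mem_coe, MulAction.mem_stabilizer_iff, Set.mem_insert_iff,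
    Set.mem_singleton_iff]
  have hneg : (-1 : SL(2, ℤ)) • τ = τ := by simp
  refine ⟨fun h ↦ ?_, by rintro (rfl | rfl); exacts [one_smul _ _, hneg]⟩
  have e4 := E₄_smul γ τ
  have e6 := E₆_smul γ τ
  rw [h, eq_comm] at e4 e6
  have e4 := mul_eq_right₀ h4 |>.mp e4
  have e6 := mul_eq_right₀ h6 |>.mp e6
  have e2 : denom γ τ ^ 2 = 1 := by
    rw [show 6 = 4 + 2 by rfl, pow_add, e4, one_mul] at e6
    exact e6
  rw [denom_coe] at e2
  rcases eq_or_eq_neg_of_sq_eq_sq _ 1 (e2.trans (one_pow 2).symm) with e | e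
  · have := int_mul_add_eq_zero (τ := τ) (s := γ 1 0) (t := γ 1 1 - 1) (by
      push_cast; linear_combination e)
    exact .inl (eq_of_bottom_eq h (one_smul _ _) this.1 (sub_eq_zero.mp this.2))
  · have := int_mul_add_eq_zero (τ := τ) (s := γ 1 0) (t := γ 1 1 + 1) (by
      push_cast; linear_combination e)
    exact .inr (eq_of_bottom_eq h hneg this.1 (eq_neg_of_add_eq_zero_left this.2))

lemma stabilizer_I : (MulAction.stabilizer SL(2, ℤ) UpperHalfPlane.I : Set SL(2, ℤ)) =
    {1, -1, ModularGroup.S, -ModularGroup.S} := by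
  ext γ
  simp only [SetLike.mem_coe, MulAction.mem_stabilizer_iff, Set.mem_insert_iff,
    Set.mem_singleton_iff]
  have hneg (δ : SL(2, ℤ)) (h : δ • UpperHalfPlane.I = UpperHalfPlane.I) :
      (-δ) • UpperHalfPlane.I = UpperHalfPlane.I := by rwa [ModularGroup.SL_neg_smul]
  refine ⟨fun h ↦ ?_, by
    rintro (rfl | rfl | rfl | rfl)
    exacts [one_smul _ _, hneg _ (one_smul _ _), S_smul_I, hneg _ S_smul_I]⟩
  have hI := I_sq'
  have h' := (smul_eq_self_iff _ _).mp h
  rw [UpperHalfPlane.coe_I] at h' hI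
  have h1 := int_mul_add_eq_zero (τ := UpperHalfPlane.I) (s := γ 0 0 - γ 1 1)
    (t := γ 0 1 + γ 1 0) (by push_cast; linear_combination h' + γ 1 0 * hI)
  have hdet : γ 0 0 * γ 1 1 - γ 0 1 * γ 1 0 = 1 := by
    rw [← Matrix.det_fin_two]; exact γ.2
  have hsq : γ 1 1 ^ 2 + γ 1 0 ^ 2 = 1 := by
    linear_combination hdet - γ 1 1 * h1.1 + γ 1 0 * h1.2
  have hd : -1 ≤ γ 1 1 ∧ γ 1 1 ≤ 1 :=
    ⟨by nlinarith [sq_nonneg (γ 1 0)], by nlinarith [sq_nonneg (γ 1 0)]⟩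
  have hc : -1 ≤ γ 1 0 ∧ γ 1 0 ≤ 1 :=
    ⟨by nlinarith [sq_nonneg (γ 1 1)], by nlinarith [sq_nonneg (γ 1 1)]⟩
  have key : (γ 1 0 = 0 ∧ γ 1 1 = 1) ∨ (γ 1 0 = 0 ∧ γ 1 1 = -1) ∨ (γ 1 0 = 1 ∧ γ 1 1 = 0) ∨
      (γ 1 0 = -1 ∧ γ 1 1 = 0) := by
    obtain ⟨⟨d1, d2⟩, c1, c2⟩ := And.intro hd hc
    generalize γ 1 0 = c at *
    generalize γ 1 1 = d at *
    interval_cases c <;> interval_cases d <;> simp_all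
  rcases key with ⟨k1, k2⟩ | ⟨k1, k2⟩ | ⟨k1, k2⟩ | ⟨k1, k2⟩
  · exact .inl (eq_of_bottom_eq h (one_smul _ _) k1 k2)
  · exact .inr (.inl (eq_of_bottom_eq h (hneg _ (one_smul _ _)) k1 k2))
  · exact .inr (.inr (.inl (eq_of_bottom_eq h S_smul_I k1 k2)))
  · exact .inr (.inr (.inr (eq_of_bottom_eq h (hneg _ S_smul_I) k1 k2)))

lemma stabilizer_rho : (MulAction.stabilizer SL(2, ℤ) rho : Set SL(2, ℤ)) =
    {1, -1, rhoStab, -rhoStab, rhoStab ^ 2, -rhoStab ^ 2} := by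
  ext γ
  simp only [SetLike.mem_coe, MulAction.mem_stabilizer_iff, Set.mem_insert_iff,
    Set.mem_singleton_iff]
  have hneg (δ : SL(2, ℤ)) (h : δ • rho = rho) :
      (-δ) • rho = rho := by rwa [ModularGroup.SL_neg_smul]
  have hrs : rhoStab ^ 2 • rho = rho := by rw [pow_two, mul_smul, rho_smul, rho_smul]
  refine ⟨fun h ↦ ?_, by
    rintro (rfl | rfl | rfl | rfl | rfl | rfl)
    exacts [one_smul _ _, hneg _ (one_smul _ _), rho_smul, hneg _ rho_smul, hrs, hneg _ hrs]⟩
  have hI := rho_sq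
  have h' := (smul_eq_self_iff _ _).mp h
  have h1 := int_mul_add_eq_zero (τ := rho) (s := γ 0 0 - γ 1 1 + γ 1 0)
    (t := γ 0 1 + γ 1 0) (by push_cast; linear_combination h' + γ 1 0 * hI)
  have hdet : γ 0 0 * γ 1 1 - γ 0 1 * γ 1 0 = 1 := by
    rw [← Matrix.det_fin_two]; exact γ.2
  have hsq : γ 1 1 ^ 2 - γ 1 0 * γ 1 1 + γ 1 0 ^ 2 = 1 := by
    linear_combination hdet - γ 1 1 * h1.1 + γ 1 0 * h1.2
  have hd : -1 ≤ γ 1 1 ∧ γ 1 1 ≤ 1 :=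
    ⟨by nlinarith [sq_nonneg (2 * γ 1 0 - γ 1 1)], by nlinarith [sq_nonneg (2 * γ 1 0 - γ 1 1)]⟩
  have hc : -1 ≤ γ 1 0 ∧ γ 1 0 ≤ 1 :=
    ⟨by nlinarith [sq_nonneg (2 * γ 1 1 - γ 1 0)], by nlinarith [sq_nonneg (2 * γ 1 1 - γ 1 0)]⟩
  have key : (γ 1 0 = 0 ∧ γ 1 1 = 1) ∨ (γ 1 0 = 0 ∧ γ 1 1 = -1) ∨ (γ 1 0 = 1 ∧ γ 1 1 = 1) ∨
      (γ 1 0 = -1 ∧ γ 1 1 = -1) ∨ (γ 1 0 = 1 ∧ γ 1 1 = 0) ∨ (γ 1 0 = -1 ∧ γ 1 1 = 0) := by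
    obtain ⟨⟨d1, d2⟩, c1, c2⟩ := And.intro hd hc
    generalize γ 1 0 = c at *
    generalize γ 1 1 = d at *
    interval_cases c <;> interval_cases d <;> simp_all
  rcases key with ⟨k1, k2⟩ | ⟨k1, k2⟩ | ⟨k1, k2⟩ | ⟨k1, k2⟩ | ⟨k1, k2⟩ | ⟨k1, k2⟩
  · exact .inl (eq_of_bottom_eq h (one_smul _ _) k1 k2)
  · exact .inr (.inl (eq_of_bottom_eq h (hneg _ (one_smul _ _)) k1 k2))
  · exact .inr (.inr (.inl (eq_of_bottom_eq h rho_smul k1 k2)))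
  · exact .inr (.inr (.inr (.inl (eq_of_bottom_eq h (hneg _ rho_smul) k1 k2))))
  · exact .inr (.inr (.inr (.inr (.inl (eq_of_bottom_eq h hrs (k1.trans (by decide))
      (k2.trans (by decide)))))))
  · exact .inr (.inr (.inr (.inr (.inr (eq_of_bottom_eq h (hneg _ hrs) (k1.trans (by decide))
      (k2.trans (by decide)))))))

lemma card_stabilizer_eq_of_jH_eq {τ τ' : ℍ} (h : jH τ = jH τ') :
    Nat.card (MulAction.stabilizer SL(2, ℤ) τ) = Nat.card (MulAction.stabilizer SL(2, ℤ) τ') := by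
  obtain ⟨γ, hγ⟩ := exists_smul_eq_of_jH_eq h.symm
  exact Nat.card_congr (MulAction.stabilizerEquivStabilizerOfOrbitRel
    (MulAction.orbitRel_apply.mpr ⟨γ, hγ⟩)).toEquiv

lemma card_stabilizer (τ : ℍ) :
    Nat.card (MulAction.stabilizer SL(2, ℤ) τ) = 2 * ramif (jH τ) := by
  rw [ramif]
  split_ifs with h0 h1
  · rw [card_stabilizer_eq_of_jH_eq (h0.trans jH_rho.symm)]
    change Nat.card (MulAction.stabilizer SL(2, ℤ) rho : Set SL(2, ℤ)) = _
    rw [stabilizer_rho, Nat.card_coe_set_eq, Set.ncard_eq_toFinset_card']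
    decide
  · rw [card_stabilizer_eq_of_jH_eq (h1.trans jH_I.symm)]
    change Nat.card (MulAction.stabilizer SL(2, ℤ) UpperHalfPlane.I : Set SL(2, ℤ)) = _
    rw [stabilizer_I, Nat.card_coe_set_eq, Set.ncard_eq_toFinset_card']
    decide
  · change Nat.card (MulAction.stabilizer SL(2, ℤ) τ : Set SL(2, ℤ)) = _
    rw [stabilizer_eq_of_jH_ne h0 h1, Nat.card_coe_set_eq, Set.ncard_eq_toFinset_card']
    decide

/-- Indices `(d, b)`, with `d ∣ n` and `0 ≤ b < d`, of representatives of the integral matrices of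
determinant `n` modulo the modular group. -/
def heckeSet (n : ℕ) : Finset (Σ _ : ℕ, ℕ) := n.divisors.sigma fun d ↦ Finset.range d

/-- The representative `(n / d, b; 0, d)`. -/
def heckeMat (n : ℕ) (x : Σ _ : ℕ, ℕ) : Matrix (Fin 2) (Fin 2) ℤ :=
  !![((n / x.1 : ℕ) : ℤ), x.2; 0, x.1]

/-- The indices of the nonscalar representatives. -/
def heckeSet' (n : ℕ) : Finset (Σ _ : ℕ, ℕ) := {x ∈ heckeSet n | ¬(x.1 * x.1 = n ∧ x.2 = 0)}

lemma mem_heckeSet {n : ℕ} {x : Σ _ : ℕ, ℕ} : x ∈ heckeSet n ↔ (x.1 ∣ n ∧ n ≠ 0) ∧ x.2 < x.1 := by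
  simp [heckeSet]

lemma heckeMat_det {n : ℕ} {x : Σ _ : ℕ, ℕ} (hx : x ∈ heckeSet n) : (heckeMat n x).det = n := by
  rw [heckeMat, Matrix.det_fin_two_of]
  have := Nat.div_mul_cancel (mem_heckeSet.mp hx).1.1
  simp only [mul_zero, sub_zero]
  exact_mod_cast this

lemma heckeMat_det_pos {n : ℕ} {x : Σ _ : ℕ, ℕ} (hx : x ∈ heckeSet n) :
    0 < (heckeMat n x).det := by
  rw [heckeMat_det hx]
  exact_mod_cast Nat.pos_of_ne_zero (mem_heckeSet.mp hx).1.2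

lemma exists_eq_mul_heckeMat {n : ℕ} (hn : n ≠ 0) (A : Matrix (Fin 2) (Fin 2) ℤ) (hA : A.det = n) :
    ∃ γ : SL(2, ℤ), ∃ x ∈ heckeSet n, A = γ.1 * heckeMat n x := by
  have hn' : (n : ℤ) ≠ 0 := by exact_mod_cast hn
  suffices ∀ A : FixedDetMatrix (Fin 2) ℤ n, ∃ γ : SL(2, ℤ), ∃ x ∈ heckeSet n,
      A.1 = γ.1 * heckeMat n x from this ⟨A, hA⟩
  intro A
  induction A using FixedDetMatrices.induction_on hn' with
  | h0 A h10 h00 h01 h11 =>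
    have hdet : A.1 0 0 * A.1 1 1 = n := by
      have := A.2
      rw [Matrix.det_fin_two, h10, mul_zero, sub_zero] at this
      exact this
    have hd : 0 < A.1 1 1 := by
      refine pos_of_mul_pos_right (a := A.1 0 0) ?_ h00.le
      rw [hdet]; positivity
    rw [abs_of_nonneg h01, abs_of_pos hd] at h11
    refine ⟨1, ⟨(A.1 1 1).toNat, (A.1 0 1).toNat⟩, mem_heckeSet.mpr ⟨⟨?_, hn⟩, by lia⟩, ?_⟩
    · zify
      rw [Int.toNat_of_nonneg hd.le]
      exact ⟨A.1 0 0, hdet.symm.trans (mul_comm _ _)⟩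
    · rw [Matrix.SpecialLinearGroup.coe_one, one_mul]
      ext i j
      fin_cases i <;> fin_cases j
      · simp only [heckeMat]
        push_cast
        simp [hd.le]
        exact (Int.ediv_eq_of_eq_mul_left hd.ne' hdet.symm).symm
      · simp [heckeMat, h01]
      · simp [heckeMat, h10]
      · simp [heckeMat, hd.le]
  | hS B h =>
    obtain ⟨γ, x, hx, h⟩ := h
    exact ⟨ModularGroup.S * γ, x, hx, by
      rw [FixedDetMatrices.smul_coe, h, Matrix.SpecialLinearGroup.coe_mul, mul_assoc]⟩
  | hT B h =>
    obtain ⟨γ, x, hx, h⟩ := h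
    exact ⟨ModularGroup.T * γ, x, hx, by
      rw [FixedDetMatrices.smul_coe, h, Matrix.SpecialLinearGroup.coe_mul, mul_assoc]⟩

lemma eq_of_mul_heckeMat_eq {n : ℕ} {γ : SL(2, ℤ)} {x y : Σ _ : ℕ, ℕ} (hx : x ∈ heckeSet n)
    (hy : y ∈ heckeSet n) (h : γ.1 * heckeMat n x = heckeMat n y) : γ = 1 ∧ x = y := by
  have e := fun i j ↦ congrFun (congrFun h i) j
  have e00 := e 0 0
  have e01 := e 0 1
  have e10 := e 1 0
  have e11 := e 1 1
  have dx := heckeMat_det hx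
  have dy := heckeMat_det hy
  have hγ := γ.2
  obtain ⟨d, b⟩ := x
  obtain ⟨d', b'⟩ := y
  obtain ⟨⟨hx1, hn⟩, hx2⟩ := mem_heckeSet.mp hx
  obtain ⟨⟨hy1, -⟩, hy2⟩ := mem_heckeSet.mp hy
  simp only at hx1 hx2 hy1 hy2
  have ha : 0 < n / d := Nat.div_pos (Nat.le_of_dvd (Nat.pos_of_ne_zero hn) hx1) (by lia)
  have ha' : 0 < n / d' := Nat.div_pos (Nat.le_of_dvd (Nat.pos_of_ne_zero hn) hy1) (by lia)
  rw [Matrix.det_fin_two] at hγ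
  simp only [heckeMat, Matrix.mul_apply, Fin.sum_univ_two, Matrix.of_apply, Matrix.cons_val',
    Matrix.cons_val_zero, Matrix.cons_val_one, Matrix.cons_val_fin_one, mul_zero, add_zero]
    at e00 e01 e10 e11
  generalize n / d = a at *
  generalize n / d' = a' at *
  have c0 : γ.1 1 0 = 0 := (mul_eq_zero.mp e10).resolve_right (by lia)
  rw [c0] at e11 hγ
  have hpos : 0 < γ.1 0 0 := by
    refine pos_of_mul_pos_left (b := (a : ℤ)) ?_ (by positivity)
    rw [e00]; exact_mod_cast ha'
  have h11 : γ.1 0 0 = 1 ∧ γ.1 1 1 = 1 := by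
    rcases Int.mul_eq_one_iff_eq_one_or_neg_one.mp
      (show γ.1 0 0 * γ.1 1 1 = 1 by linarith) with h | h
    · exact h
    · lia
  rw [h11.2] at e11
  rw [h11.1] at e01
  have hdd : d = d' := by lia
  subst hdd
  have h01 : γ.1 0 1 = 0 := by
    have hb : γ.1 0 1 * d = (b' : ℤ) - b := by linarith
    have h1 : |γ.1 0 1| * d < 1 * d := by
      rw [← abs_of_nonneg (show (0 : ℤ) ≤ d by positivity), ← abs_mul,
        abs_of_nonneg (show (0 : ℤ) ≤ d by positivity), hb, abs_lt]
      constructor <;> lia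
    have := lt_of_mul_lt_mul_right h1 (by positivity)
    exact Int.abs_lt_one_iff.mp this
  refine ⟨?_, ?_⟩
  · ext i j
    fin_cases i <;> fin_cases j
    exacts [h11.1, h01, c0, h11.2]
  · rw [h01] at e01
    have : b = b' := by lia
    rw [this]

lemma heckeMat_eq_smul_one {n : ℕ} {x : Σ _ : ℕ, ℕ} (hx : x ∈ heckeSet n)
    (h : x.1 * x.1 = n ∧ x.2 = 0) : heckeMat n x = (x.1 : ℤ) • (1 : Matrix (Fin 2) (Fin 2) ℤ) := by
  have hpos : 0 < x.1 := Nat.zero_lt_of_lt (mem_heckeSet.mp hx).2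
  have : n / x.1 = x.1 := by rw [← h.1, Nat.mul_div_cancel _ hpos]
  ext i j
  fin_cases i <;> fin_cases j <;> simp [heckeMat, this, h.2]

/-- A nonscalar representative is not an integral multiple of an element of the modular group. -/
lemma heckeMat_ne_smul {n : ℕ} {x : Σ _ : ℕ, ℕ} (hx : x ∈ heckeSet' n) (k : ℤ) (γ : SL(2, ℤ)) :
    heckeMat n x ≠ k • γ.1 := by
  intro h
  obtain ⟨hx, hx'⟩ := Finset.mem_filter.mp hx
  refine hx' ?_
  have e (i j) := congrFun (congrFun h i) j
  have e00 := e 0 0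
  have e01 := e 0 1
  have e10 := e 1 0
  have e11 := e 1 1
  have hγ := γ.2
  have hdet := heckeMat_det hx
  obtain ⟨⟨hx1, hn⟩, hx2⟩ := mem_heckeSet.mp hx
  have hdiv := Nat.div_mul_cancel hx1
  obtain ⟨d, b⟩ := x
  simp only at hx1 hx2 hdiv
  rw [Matrix.det_fin_two] at hγ
  simp [heckeMat] at e00 e01 e10 e11
  rw [h, Matrix.det_smul, γ.2] at hdet
  simp only [Fintype.card_fin, mul_one] at hdet
  have hk : k ≠ 0 := by rintro rfl; simp at hdet; exact hn (by exact_mod_cast hdet.symm)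
  have c0 := e10.resolve_left hk
  rw [c0] at hγ
  have hd2 : (d : ℤ) * d = n := by
    rcases Int.mul_eq_one_iff_eq_one_or_neg_one.mp
      (show γ.1 0 0 * γ.1 1 1 = 1 by linarith) with h | h
    all_goals rw [e11, ← hdet, h.2]; ring
  refine ⟨by exact_mod_cast hd2, ?_⟩
  have hdk : (d : ℤ) ∣ b := by
    rw [e01]
    rcases Int.mul_eq_one_iff_eq_one_or_neg_one.mp
      (show γ.1 0 0 * γ.1 1 1 = 1 by linarith) with h | h
    · rw [e11, h.2, mul_one]; exact dvd_mul_right _ _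
    · rw [e11, h.2, mul_neg_one, neg_dvd]; exact dvd_mul_right _ _
  exact Nat.eq_zero_of_dvd_of_lt (by exact_mod_cast hdk) hx2

/-- The product of the differences `j τ - j (M τ)` over the nonscalar classes `M` of determinant
`n`. -/
noncomputable def modProd (n : ℕ) (τ : ℍ) : ℂ :=
  ∏ x ∈ heckeSet' n, (jH τ - jH (mob (heckeMat n x) • τ))

lemma mem_heckeSet_of_mem {n : ℕ} {x : Σ _ : ℕ, ℕ} (hx : x ∈ heckeSet' n) : x ∈ heckeSet n :=
  (Finset.mem_filter.mp hx).1

lemma heckeSet'_ne_zero {n : ℕ} {x : Σ _ : ℕ, ℕ} (hx : x ∈ heckeSet' n) : n ≠ 0 :=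
  (mem_heckeSet.mp (mem_heckeSet_of_mem hx)).1.2

lemma exists_mul_eq_mul_heckeMat (n : ℕ) (γ : SL(2, ℤ)) (x : Σ _ : ℕ, ℕ) (hx : x ∈ heckeSet' n) :
    ∃ y ∈ heckeSet' n, ∃ δ : SL(2, ℤ), heckeMat n x * γ.1 = δ.1 * heckeMat n y := by
  have hx1 := mem_heckeSet_of_mem hx
  obtain ⟨δ, y, hy, h⟩ := exists_eq_mul_heckeMat (heckeSet'_ne_zero hx) (heckeMat n x * γ.1) (by
    rw [Matrix.det_mul, heckeMat_det hx1, γ.2, mul_one])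
  refine ⟨y, Finset.mem_filter.mpr ⟨hy, fun hs ↦ ?_⟩, δ, h⟩
  rw [heckeMat_eq_smul_one hy hs, Matrix.mul_smul, mul_one] at h
  refine heckeMat_ne_smul hx y.1 (δ * γ⁻¹) ?_
  rw [Matrix.SpecialLinearGroup.coe_mul, ← Matrix.smul_mul, ← h, mul_assoc,
    ← Matrix.SpecialLinearGroup.coe_mul, mul_inv_cancel, Matrix.SpecialLinearGroup.coe_one, mul_one]

lemma modProd_smul (n : ℕ) (γ : SL(2, ℤ)) (τ : ℍ) : modProd n (γ • τ) = modProd n τ := by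
  choose! σ hσ δ hδ using exists_mul_eq_mul_heckeMat n γ
  have hinj : Set.InjOn σ (heckeSet' n) := by
    intro x hx y hy hxy
    have hx' := hδ x hx
    rw [hxy] at hx'
    have hy' := hδ y hy
    have h1 : heckeMat n y = (δ y * (δ x)⁻¹).1 * heckeMat n x := by
      have e : heckeMat n (σ y) = ((δ x)⁻¹).1 * (heckeMat n x * γ.1) := by
        rw [hx', ← mul_assoc, ← Matrix.SpecialLinearGroup.coe_mul, inv_mul_cancel,
          Matrix.SpecialLinearGroup.coe_one, one_mul]
      rw [e] at hy'
      have := congrArg (· * (γ⁻¹).1) hy'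
      simp only [mul_assoc] at this
      rw [← Matrix.SpecialLinearGroup.coe_mul, mul_inv_cancel, Matrix.SpecialLinearGroup.coe_one,
        mul_one, mul_one, ← mul_assoc, ← Matrix.SpecialLinearGroup.coe_mul] at this
      exact this
    exact (eq_of_mul_heckeMat_eq (mem_heckeSet_of_mem hx) (mem_heckeSet_of_mem hy) h1.symm).2
  refine Finset.prod_nbij σ hσ hinj
    (Finset.surjOn_of_injOn_of_card_le _ hσ hinj le_rfl) fun x hx ↦ ?_
  have px := heckeMat_det_pos (mem_heckeSet_of_mem hx)
  have py := heckeMat_det_pos (mem_heckeSet_of_mem (hσ x hx))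
  rw [jH_smul, ← mob_coe_smul, ← mob_mul_smul px (by rw [γ.2]; norm_num), hδ x hx,
    mob_mul_smul (by rw [(δ x).2]; norm_num) py, mob_coe_smul, jH_smul]

lemma mdiff_jH_mob {A : Matrix (Fin 2) (Fin 2) ℤ} (hA : 0 < A.det) :
    MDiff (fun τ ↦ jH (mob A • τ)) :=
  mdiff_jH.comp (UpperHalfPlane.mdifferentiable_smul (mob_det_pos hA))

lemma mdiff_modProd (n : ℕ) : MDiff (modProd n) := by
  have h : modProd n = ∏ x ∈ heckeSet' n, (jH - fun τ ↦ jH (mob (heckeMat n x) • τ)) := by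
    ext τ
    simp [modProd]
  rw [h]
  exact MDifferentiable.prod fun x hx ↦
    mdiff_jH.sub (mdiff_jH_mob (heckeMat_det_pos (mem_heckeSet_of_mem hx)))

lemma aut_mul {A B : Matrix (Fin 2) (Fin 2) ℤ} (hB : 0 < B.det) (τ : ℍ) :
    ((A * B) 1 0 * τ + (A * B) 1 1 : ℂ) =
      (A 1 0 * (mob B • τ : ℍ) + A 1 1) * (B 1 0 * τ + B 1 1) := by
  have := mob_denom_ne_zero hB τ
  rw [coe_mob_smul hB]
  simp only [Matrix.mul_apply, Fin.sum_univ_two]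
  push_cast
  field_simp
  ring

lemma eq_smul_of_bottom_right {A : Matrix (Fin 2) (Fin 2) ℤ} {k : ℤ} (γ : SL(2, ℤ))
    (h00 : A 0 0 = k * γ 0 0) (h01 : A 0 1 = k * γ 0 1) (h10 : A 1 0 = k * γ 1 0)
    (h11 : A 1 1 = k * γ 1 1) : ∃ (k : ℤ) (γ : SL(2, ℤ)), A = k • γ.1 := by
  refine ⟨k, γ, ?_⟩
  ext i j
  fin_cases i <;> fin_cases j <;> simpa

lemma exists_eq_smul_of_pow_one {A : Matrix (Fin 2) (Fin 2) ℤ} (hA : 0 < A.det) {τ : ℍ}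
    (hfix : mob A • τ = τ) (h : (A 1 0 * τ + A 1 1 : ℂ) ^ 2 = A.det) :
    ∃ (k : ℤ) (γ : SL(2, ℤ)), A = k • γ.1 := by
  rw [mob_smul_eq_self_iff hA] at hfix
  have hdet := Matrix.det_fin_two A
  have h1 := int_mul_add_eq_zero (τ := τ) (s := A 1 0 * (A 0 0 + A 1 1))
    (t := A 0 1 * A 1 0 + A 1 1 ^ 2 - A.det) (by
      simp only [Int.cast_add, Int.cast_sub, Int.cast_mul, Int.cast_pow]
      linear_combination h + A 1 0 * hfix)
  have c0 : A 1 0 = 0 := by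
    refine (mul_eq_zero.mp h1.1).resolve_right fun h0 ↦ ?_
    have : A 1 1 * (A 0 0 + A 1 1) = 0 := by rw [h0, mul_zero]
    nlinarith [h1.2]
  have h2 := int_mul_add_eq_zero (τ := τ) (s := A 0 0 - A 1 1) (t := A 0 1) (by
      push_cast
      rw [c0] at hfix
      linear_combination hfix)
  exact eq_smul_of_bottom_right (k := A 1 1) 1 (by simpa using sub_eq_zero.mp h2.1)
    (by simpa using h2.2) (by simpa using c0) (by simp)

lemma exists_eq_smul_of_pow_two {A : Matrix (Fin 2) (Fin 2) ℤ} (hA : 0 < A.det)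
    (hfix : mob A • UpperHalfPlane.I = UpperHalfPlane.I)
    (h : ((A 1 0 * (UpperHalfPlane.I : ℍ) + A 1 1 : ℂ) ^ 2) ^ 2 = A.det ^ 2) :
    ∃ (k : ℤ) (γ : SL(2, ℤ)), A = k • γ.1 := by
  rw [mob_smul_eq_self_iff hA] at hfix
  have hI := I_sq'
  rw [UpperHalfPlane.coe_I] at h hfix hI
  have hdet := Matrix.det_fin_two A
  have h1 := int_mul_add_eq_zero (τ := UpperHalfPlane.I) (s := A 0 0 - A 1 1)
    (t := A 0 1 + A 1 0) (by
    push_cast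
    linear_combination hfix + A 1 0 * hI)
  have ha : A 0 0 = A 1 1 := sub_eq_zero.mp h1.1
  have hb : A 0 1 = - A 1 0 := eq_neg_of_add_eq_zero_left h1.2
  rw [ha, hb] at hdet
  have h2 := int_mul_add_eq_zero (τ := UpperHalfPlane.I)
    (s := 4 * A 1 0 * A 1 1 * (A 1 1 ^ 2 - A 1 0 ^ 2))
    (t := (A 1 1 ^ 2 - A 1 0 ^ 2) ^ 2 - 4 * A 1 0 ^ 2 * A 1 1 ^ 2 - A.det ^ 2) (by
    rw [UpperHalfPlane.coe_I]
    simp only [Int.cast_sub, Int.cast_mul, Int.cast_pow, Int.cast_ofNat]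
    linear_combination h - (A 1 0 ^ 4 * (Complex.I ^ 2 - 1) + 4 * A 1 0 ^ 3 * A 1 1 * Complex.I +
      6 * A 1 0 ^ 2 * A 1 1 ^ 2 : ℂ) * hI)
  rw [hdet] at h2
  have h3 : A 1 0 * A 1 1 = 0 := by
    have : 8 * (A 1 0 * A 1 1) ^ 2 = 0 := by linear_combination -h2.2
    simpa using this
  rcases mul_eq_zero.mp h3 with h3 | h3
  · exact eq_smul_of_bottom_right (k := A 1 1) 1 (by simpa using ha)
      (by simpa [h3] using hb) (by simpa using h3) (by simp)
  · exact eq_smul_of_bottom_right (k := A 1 0) ModularGroup.S (by simp [ModularGroup.S, ha, h3])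
      (by simp [ModularGroup.S, hb]) (by simp [ModularGroup.S]) (by simp [ModularGroup.S, h3])

lemma exists_eq_smul_of_pow_three {A : Matrix (Fin 2) (Fin 2) ℤ} (hA : 0 < A.det)
    (hfix : mob A • rho = rho) (h : ((A 1 0 * rho + A 1 1 : ℂ) ^ 2) ^ 3 = A.det ^ 3) :
    ∃ (k : ℤ) (γ : SL(2, ℤ)), A = k • γ.1 := by
  rw [mob_smul_eq_self_iff hA] at hfix
  have hI := rho_sq
  have hdet := Matrix.det_fin_two A
  have h1 := int_mul_add_eq_zero (τ := rho) (s := A 0 0 - A 1 1 + A 1 0) (t := A 0 1 + A 1 0) (by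
    push_cast
    linear_combination hfix + A 1 0 * hI)
  have ha : A 0 0 = A 1 1 - A 1 0 := by linarith [h1.1]
  have hb : A 0 1 = - A 1 0 := eq_neg_of_add_eq_zero_left h1.2
  rw [ha, hb] at hdet
  generalize hc : A 1 0 = c at *
  generalize hd : A 1 1 = d at *
  obtain ⟨u, hu⟩ : ∃ u, u = c ^ 3 + d ^ 3 - 3 * c ^ 2 * d := ⟨_, rfl⟩
  obtain ⟨v, hv⟩ : ∃ v, v = 3 * c * d * (d - c) := ⟨_, rfl⟩
  have h3 : ((c : ℂ) * rho + d) ^ 3 = u + v * rho := by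
    rw [hu, hv]
    push_cast
    linear_combination (c ^ 3 * (rho - 1) + 3 * c ^ 2 * d : ℂ) * hI
  have h2 := int_mul_add_eq_zero (τ := rho) (s := 2 * u * v - v ^ 2)
    (t := u ^ 2 - v ^ 2 - A.det ^ 3) (by
    rw [← pow_mul, mul_comm 2 3, pow_mul, h3] at h
    simp only [Int.cast_sub, Int.cast_mul, Int.cast_pow, Int.cast_ofNat]
    linear_combination h - v ^ 2 * hI)
  have hn : A.det ^ 3 = u ^ 2 - u * v + v ^ 2 := by
    rw [hdet, hu, hv]; ring
  have hv0 : v = 0 := by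
    refine pow_eq_zero_iff two_ne_zero |>.mp ?_
    linarith [h2.1, h2.2]
  have h3 : c * d * (d - c) = 0 := by linarith
  rcases mul_eq_zero.mp h3 with h3 | h3
  · rcases mul_eq_zero.mp h3 with h3 | h3
    · exact eq_smul_of_bottom_right (k := d) 1 (by simp [ha, h3])
        (by simp [hb, h3]) (by simp [hc, h3]) (by simp [hd])
    · exact eq_smul_of_bottom_right (k := c) (rhoStab ^ 2)
        (by rw [ha, h3, show (rhoStab ^ 2) 0 0 = -1 by decide]; ring)
        (by rw [hb, show (rhoStab ^ 2) 0 1 = -1 by decide]; ring)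
        (by rw [hc, show (rhoStab ^ 2) 1 0 = 1 by decide]; ring)
        (by rw [hd, h3, show (rhoStab ^ 2) 1 1 = 0 by decide]; ring)
  · have h3 : d = c := by linarith
    exact eq_smul_of_bottom_right (k := c) rhoStab
        (by simp [ha, h3, rhoStab]) (by simp [hb, rhoStab]) (by simp [hc, rhoStab])
        (by simp [hd, h3, rhoStab])

lemma exists_eq_smul_of_conj {A : Matrix (Fin 2) (Fin 2) ℤ} (hA : 0 < A.det) {τ τ₀ : ℍ}
    (hfix : mob A • τ = τ) (hj : jH τ₀ = jH τ) (m : ℕ)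
    (h : ((A 1 0 * τ + A 1 1 : ℂ) ^ 2) ^ m = A.det ^ m)
    (H : ∀ B : Matrix (Fin 2) (Fin 2) ℤ, 0 < B.det → mob B • τ₀ = τ₀ →
      ((B 1 0 * τ₀ + B 1 1 : ℂ) ^ 2) ^ m = B.det ^ m → ∃ (k : ℤ) (γ : SL(2, ℤ)), B = k • γ.1) :
    ∃ (k : ℤ) (γ : SL(2, ℤ)), A = k • γ.1 := by
  obtain ⟨γ, rfl⟩ := exists_smul_eq_of_jH_eq hj
  have pos (δ : SL(2, ℤ)) : 0 < δ.1.det := by rw [δ.2]; norm_num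
  have hAγ : 0 < (A * γ.1).det := by rw [Matrix.det_mul]; exact mul_pos hA (pos γ)
  have hB : (γ⁻¹.1 * (A * γ.1)).det = A.det := by
    rw [Matrix.det_mul, Matrix.det_mul, γ.2, γ⁻¹.2]; ring
  have hBfix : mob (γ⁻¹.1 * (A * γ.1)) • τ₀ = τ₀ := by
    rw [mob_mul_smul (pos _) hAγ, mob_mul_smul hA (pos _), mob_coe_smul, mob_coe_smul, hfix,
      inv_smul_smul]
  have hγγ : γ.1 * (γ⁻¹.1 * (A * γ.1)) = A * γ.1 := by
    rw [← mul_assoc, ← Matrix.SpecialLinearGroup.coe_mul, mul_inv_cancel,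
      Matrix.SpecialLinearGroup.coe_one, one_mul]
  have haut := aut_mul (A := γ.1) (B := γ⁻¹.1 * (A * γ.1)) (hB ▸ hA) τ₀
  rw [hγγ, aut_mul (pos γ), mob_coe_smul, hBfix, mul_comm] at haut
  have haut := mul_left_cancel₀ (mob_denom_ne_zero (pos γ) τ₀) haut
  obtain ⟨k, δ, h'⟩ := H _ (hB ▸ hA) hBfix (by rw [← haut, h, hB])
  refine ⟨k, γ * δ * γ⁻¹, ?_⟩
  rw [h'] at hγγ
  have := congrArg (· * γ⁻¹.1) hγγ
  simp only [mul_assoc] at this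
  rw [← Matrix.SpecialLinearGroup.coe_mul γ γ⁻¹, mul_inv_cancel, Matrix.SpecialLinearGroup.coe_one,
    mul_one] at this
  rw [← this, Matrix.SpecialLinearGroup.coe_mul, Matrix.SpecialLinearGroup.coe_mul,
    Matrix.smul_mul, Matrix.mul_smul, mul_assoc]

lemma exists_eq_smul_of_aut_pow {A : Matrix (Fin 2) (Fin 2) ℤ} (hA : 0 < A.det) {τ : ℍ}
    (hfix : mob A • τ = τ)
    (h : ((A 1 0 * τ + A 1 1 : ℂ) ^ 2) ^ ramif (jH τ) = A.det ^ ramif (jH τ)) :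
    ∃ (k : ℤ) (γ : SL(2, ℤ)), A = k • γ.1 := by
  unfold ramif at h
  split_ifs at h with h0 h1
  · exact exists_eq_smul_of_conj hA hfix (jH_rho.trans h0.symm) 3 h
      fun B hB hfix h ↦ exists_eq_smul_of_pow_three hB hfix h
  · exact exists_eq_smul_of_conj hA hfix (jH_I.trans h1.symm) 2 h
      fun B hB hfix h ↦ exists_eq_smul_of_pow_two hB hfix h
  · exact exists_eq_smul_of_pow_one hA hfix (by simpa using h)

lemma analyticOrderAt_sub_comp {f φ : ℂ → ℂ} {a : ℂ} {k : ℕ} (hf : AnalyticAt ℂ f a)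
    (hk : analyticOrderAt f a = k) (hφ : AnalyticAt ℂ φ a) (ha : φ a = a)
    (hμ : deriv φ a ^ k ≠ 1) : analyticOrderAt (fun z ↦ f z - f (φ z)) a = k := by
  obtain ⟨g, hg, hga, hfg⟩ := hf.analyticOrderAt_eq_natCast.mp hk
  have hφg : AnalyticAt ℂ (fun z ↦ g (φ z)) a := by
    refine AnalyticAt.comp (g := g) ?_ hφ
    rwa [ha]
  have hfφ : AnalyticAt ℂ (fun z ↦ f (φ z)) a := by
    refine AnalyticAt.comp (g := f) ?_ hφ
    rwa [ha]
  have hψ : AnalyticAt ℂ (dslope φ a) a := by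
    obtain ⟨p, hp⟩ := hφ
    exact ⟨_, hp.has_fpower_series_dslope_fslope⟩
  refine (hf.sub hfφ).analyticOrderAt_eq_natCast.mpr
    ⟨fun z ↦ g z - dslope φ a z ^ k * g (φ z), hg.sub ((hψ.pow k).mul hφg), ?_, ?_⟩
  · beta_reduce
    rw [dslope_same, ha, ← one_sub_mul]
    exact mul_ne_zero (sub_ne_zero.mpr hμ.symm) hga
  · have hφt : Tendsto φ (𝓝 a) (𝓝 a) := by
      have := hφ.continuousAt.tendsto
      rwa [ha] at this
    filter_upwards [hfg, hφt.eventually hfg] with z h1 h2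
    have h3 := sub_smul_dslope φ a z
    rw [ha, smul_eq_mul] at h3
    rw [Pi.sub_apply, h1, h2, ← h3, mul_pow]
    simp only [smul_eq_mul]
    ring

lemma ordH_sub_mob {A : Matrix (Fin 2) (Fin 2) ℤ} (hA : 0 < A.det) {τ : ℍ}
    (hfix : mob A • τ = τ) (hns : ∀ (k : ℤ) (γ : SL(2, ℤ)), A ≠ k • γ.1) :
    ordH (fun τ' ↦ jH τ' - jH (mob A • τ')) τ = ramif (jH τ) := by
  have hj : MDiff (fun τ' ↦ jH τ' - jH τ) := mdiff_jH.sub mdifferentiable_const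
  have hd := mob_det_pos hA
  have hderiv : deriv (fun z ↦ ((mob A • ofComplex z : ℍ) : ℂ)) τ =
      A.det / (A 1 0 * τ + A 1 1) ^ 2 := by
    rw [UpperHalfPlane.deriv_smul hd, UpperHalfPlane.denom, mob_val hA, det_map_intCast]
    simp
  have := analyticOrderAt_sub_comp (k := ramif (jH τ)) (analyticAt_of_mdiff hj τ)
    (ordH_jH_sub τ) (UpperHalfPlane.analyticAt_smul hd τ) (by simp [hfix]) (by
      rw [hderiv, div_pow]
      intro h
      have := mob_denom_ne_zero hA τ
      rw [div_eq_one_iff_eq (pow_ne_zero _ (pow_ne_zero _ this))] at h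
      obtain ⟨k, γ, hk⟩ := exists_eq_smul_of_aut_pow hA hfix h.symm
      exact hns k γ hk)
  rw [← this]
  unfold ordH
  congr 1
  ext z
  simp

lemma ordH_prod {ι : Type} (s : Finset ι) {f : ι → ℍ → ℂ} (hf : ∀ i ∈ s, MDiff (f i)) (τ : ℍ) :
    ordH (fun τ ↦ ∏ i ∈ s, f i τ) τ = ∑ i ∈ s, ordH (f i) τ := by
  classical
  induction s using Finset.induction_on with
  | empty => simpa using ordH_eq_zero (f := fun _ ↦ 1) mdifferentiable_const one_ne_zero
  | insert i s hi ih =>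
    simp only [Finset.mem_insert, forall_eq_or_imp] at hf
    simp only [Finset.prod_insert hi, Finset.sum_insert hi]
    have h : (fun τ ↦ ∏ i ∈ s, f i τ) = ∏ i ∈ s, f i := by ext; simp
    rw [ordH_mul hf.1 (h ▸ MDifferentiable.prod hf.2), ih hf.2]

lemma ordH_jH_sub_jH_mob {n : ℕ} {x : Σ _ : ℕ, ℕ} (hx : x ∈ heckeSet' n) {τ : ℍ}
    (h : jH (mob (heckeMat n x) • τ) = jH τ) :
    ordH (fun τ' ↦ jH τ' - jH (mob (heckeMat n x) • τ')) τ = ramif (jH τ) := by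
  obtain ⟨γ, hγ⟩ := exists_smul_eq_of_jH_eq h
  have hd := heckeMat_det_pos (mem_heckeSet_of_mem hx)
  have hγd : 0 < γ.1.det := by rw [γ.2]; norm_num
  have heq : (fun τ' ↦ jH τ' - jH (mob (heckeMat n x) • τ')) =
      fun τ' ↦ jH τ' - jH (mob (γ.1 * heckeMat n x) • τ') := by
    ext τ'
    rw [mob_mul_smul hγd hd, mob_coe_smul, jH_smul]
  rw [heq]
  refine ordH_sub_mob (A := γ.1 * heckeMat n x) (by rw [Matrix.det_mul]; exact mul_pos hγd hd)
    (by rw [mob_mul_smul hγd hd, mob_coe_smul, hγ]) ?_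
  · intro k δ hk
    refine heckeMat_ne_smul hx k (γ⁻¹ * δ) ?_
    rw [Matrix.SpecialLinearGroup.coe_mul, ← Matrix.mul_smul, ← hk, ← mul_assoc,
      ← Matrix.SpecialLinearGroup.coe_mul, inv_mul_cancel, Matrix.SpecialLinearGroup.coe_one,
      one_mul]

open scoped Classical in
/-- The nonscalar classes of determinant `n` fixing the class of `τ`. -/
noncomputable def heckeFix (n : ℕ) (τ : ℍ) : Finset (Σ _ : ℕ, ℕ) :=
  {x ∈ heckeSet' n | jH (mob (heckeMat n x) • τ) = jH τ}

lemma ordH_modProd (n : ℕ) (τ : ℍ) :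
    ordH (modProd n) τ = ((heckeFix n τ).card * ramif (jH τ) : ℕ) := by
  classical
  have hm (x) (hx : x ∈ heckeSet' n) : MDiff (fun τ ↦ jH τ - jH (mob (heckeMat n x) • τ)) :=
    mdiff_jH.sub (mdiff_jH_mob (heckeMat_det_pos (mem_heckeSet_of_mem hx)))
  unfold modProd heckeFix
  rw [ordH_prod _ hm, Finset.card_filter, Finset.sum_mul, Nat.cast_sum]
  refine Finset.sum_congr rfl fun x hx ↦ ?_
  split_ifs with h
  · rw [ordH_jH_sub_jH_mob hx h, one_mul]
  · rw [ordH_eq_zero (hm x hx) (sub_ne_zero.mpr (Ne.symm h))]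
    simp

lemma ordH_eval_jH {p : Polynomial ℂ} (hp : p ≠ 0) (τ : ℍ) :
    ordH (fun τ ↦ p.eval (jH τ)) τ = (p.rootMultiplicity (jH τ) * ramif (jH τ) : ℕ) := by
  have hpoly (q : Polynomial ℂ) : MDiff (fun τ ↦ q.eval (jH τ)) := by
    induction q using Polynomial.induction_on' with
    | add p q hp hq =>
      simp only [Polynomial.eval_add]
      exact hp.add hq
    | monomial n a =>
      have : (fun τ ↦ (Polynomial.monomial n a).eval (jH τ)) = fun τ ↦ a * (jH ^ n) τ := by
        ext; simp
      rw [this]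
      exact mdifferentiable_const.mul (mdiff_jH.pow n)
  obtain ⟨q, hq, hd⟩ := Polynomial.exists_eq_pow_rootMultiplicity_mul_and_not_dvd p hp (jH τ)
  set m := p.rootMultiplicity (jH τ)
  have hj : MDiff (fun τ' ↦ jH τ' - jH τ) := mdiff_jH.sub mdifferentiable_const
  have h1 : (fun τ ↦ p.eval (jH τ)) = fun τ' ↦ (jH τ' - jH τ) ^ m * q.eval (jH τ') := by
    ext τ'
    rw [hq]
    simp
  rw [h1, ordH_mul (f := fun τ' ↦ (jH τ' - jH τ) ^ m) (hj.pow m) (hpoly q), ordH_eq_zero (hpoly q)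
    (by rwa [Polynomial.dvd_iff_isRoot] at hd), ordH_pow hj, ordH_jH_sub]
  push_cast
  simp

lemma rootMultiplicity_of_modProd {n : ℕ} {p : Polynomial ℂ} (hp : p ≠ 0)
    (h : ∀ τ, modProd n τ = p.eval (jH τ)) (τ : ℍ) :
    p.rootMultiplicity (jH τ) = (heckeFix n τ).card := by
  have h1 := ordH_modProd n τ
  rw [show modProd n = fun τ ↦ p.eval (jH τ) from funext h, ordH_eval_jH hp] at h1
  refine Nat.eq_of_mul_eq_mul_right (m := ramif (jH τ)) ?_ (by exact_mod_cast h1)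
  unfold ramif
  split_ifs <;> norm_num

/-- `f` has order `-N` at the cusp, and its normalized expansion begins `q ^ (-N) * (1 + s * q)`. -/
def HasLead (f : ℍ → ℂ) (N : ℕ) (s : ℂ) : Prop :=
  ∃ C : ℂ, C ≠ 0 ∧ (fun τ ↦ f τ * qp τ ^ N - C * (1 + s * qp τ)) =o[atImInfty] qp

lemma isLittleO_mul_sub_mul {F G A B : ℍ → ℂ} (hF : (fun τ ↦ F τ - A τ) =o[atImInfty] qp)
    (hG : (fun τ ↦ G τ - B τ) =o[atImInfty] qp) (hA : A =O[atImInfty] (1 : ℍ → ℂ))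
    (hB : B =O[atImInfty] (1 : ℍ → ℂ)) :
    (fun τ ↦ F τ * G τ - A τ * B τ) =o[atImInfty] qp := by
  have h1 : (fun τ ↦ F τ - A τ) =o[atImInfty] (1 : ℍ → ℂ) :=
    hF.trans_isBigO (tendsto_qp.isBigO_one ℂ)
  have h2 : F =O[atImInfty] (1 : ℍ → ℂ) := by simpa using! h1.isBigO.add hA
  refine ((h2.mul_isLittleO hG).add (hB.mul_isLittleO hF)).congr' ?_ ?_
  · exact .of_forall fun τ ↦ by ring
  · exact .of_forall fun τ ↦ by simp

lemma isLittleO_prod_sub_prod {ι : Type*} (S : Finset ι) {F A : ι → ℍ → ℂ}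
    (hF : ∀ i ∈ S, (fun τ ↦ F i τ - A i τ) =o[atImInfty] qp)
    (hA : ∀ i ∈ S, A i =O[atImInfty] (1 : ℍ → ℂ)) :
    (fun τ ↦ ∏ i ∈ S, F i τ - ∏ i ∈ S, A i τ) =o[atImInfty] qp := by
  classical
  suffices (fun τ ↦ ∏ i ∈ S, F i τ - ∏ i ∈ S, A i τ) =o[atImInfty] qp ∧
      (fun τ ↦ ∏ i ∈ S, A i τ) =O[atImInfty] (1 : ℍ → ℂ) from this.1
  induction S using Finset.induction_on with
  | empty => exact ⟨by simp, by simpa using! isBigO_refl (1 : ℍ → ℂ) atImInfty⟩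
  | insert i S hi ih =>
    simp only [Finset.mem_insert, forall_eq_or_imp] at hF hA
    obtain ⟨h1, h2⟩ := ih hF.2 hA.2
    simp only [Finset.prod_insert hi]
    exact ⟨isLittleO_mul_sub_mul hF.1 h1 hA.1 h2, (hA.1.mul h2).congr_right fun τ ↦ by simp⟩

lemma one_add_isBigO (C s : ℂ) : (fun τ ↦ C * (1 + s * qp τ)) =O[atImInfty] (1 : ℍ → ℂ) :=
  ((tendsto_const_nhds.add (tendsto_qp.const_mul s)).const_mul C).isBigO_one ℂ

lemma qp_mul_qp_isLittleO (C : ℂ) : (fun τ ↦ C * (qp τ * qp τ)) =o[atImInfty] qp := by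
  have : (fun τ ↦ C * qp τ) =o[atImInfty] (1 : ℍ → ℂ) :=
    (isLittleO_one_iff ℂ).mpr (by simpa using tendsto_qp.const_mul C)
  refine (this.mul_isBigO (isBigO_refl qp _)).congr (fun τ ↦ by ring) fun τ ↦ by simp

lemma HasLead.mul {f g : ℍ → ℂ} {N M : ℕ} {s t : ℂ} (hf : HasLead f N s) (hg : HasLead g M t) :
    HasLead (fun τ ↦ f τ * g τ) (N + M) (s + t) := by
  obtain ⟨C, hC, h⟩ := hf
  obtain ⟨C', hC', h'⟩ := hg
  refine ⟨C * C', mul_ne_zero hC hC', ?_⟩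
  refine ((isLittleO_mul_sub_mul h h' (one_add_isBigO _ _) (one_add_isBigO _ _)).add
    (qp_mul_qp_isLittleO (C * C' * s * t))).congr_left fun τ ↦ ?_
  ring

lemma hasLead_const {C : ℂ} (hC : C ≠ 0) : HasLead (fun _ ↦ C) 0 0 :=
  ⟨C, hC, by simp⟩

lemma hasLead_jH_sub (x : ℂ) : HasLead (fun τ ↦ jH τ - x) 1 (744 - x) := by
  refine ⟨1, one_ne_zero, ?_⟩
  have h : (fun τ ↦ jH τ - (qp τ)⁻¹ - 744) =o[atImInfty] (1 : ℍ → ℂ) :=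
    (isLittleO_one_iff ℂ).mpr (jH_isBigO.trans_tendsto tendsto_qp)
  refine (h.mul_isBigO (isBigO_refl qp _)).congr (fun τ ↦ ?_) fun τ ↦ by simp
  have := qp_ne_zero τ
  field_simp
  ring

lemma HasLead.prod {ι : Type*} (S : Finset ι) {f : ι → ℍ → ℂ} {N : ι → ℕ} {s : ι → ℂ}
    (hf : ∀ i ∈ S, HasLead (f i) (N i) (s i)) :
    HasLead (fun τ ↦ ∏ i ∈ S, f i τ) (∑ i ∈ S, N i) (∑ i ∈ S, s i) := by
  classical
  induction S using Finset.induction_on with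
  | empty => simpa using hasLead_const one_ne_zero
  | insert i S hi ih =>
    simp only [Finset.mem_insert, forall_eq_or_imp] at hf
    simp only [Finset.prod_insert hi, Finset.sum_insert hi]
    exact hf.1.mul (ih hf.2)

lemma hasLead_multiset_prod (S : Multiset ℂ) :
    HasLead (fun τ ↦ (S.map fun x ↦ jH τ - x).prod) S.card (S.map fun x ↦ 744 - x).sum := by
  induction S using Multiset.induction_on with
  | empty => simpa using hasLead_const one_ne_zero
  | cons x S ih =>
    simp only [Multiset.map_cons, Multiset.prod_cons, Multiset.sum_cons, Multiset.card_cons,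
      add_comm S.card 1]
    exact (hasLead_jH_sub x).mul ih

lemma hasLead_eval_jH {p : Polynomial ℂ} (hp : p ≠ 0) :
    HasLead (fun τ ↦ p.eval (jH τ)) p.roots.card (p.roots.map fun x ↦ 744 - x).sum := by
  have h := (hasLead_const (Polynomial.leadingCoeff_ne_zero.mpr hp)).mul
    (hasLead_multiset_prod p.roots)
  rw [zero_add, zero_add] at h
  convert h using 2 with τ
  conv_lhs => rw [(IsAlgClosed.splits p).eq_prod_roots]
  simp [Polynomial.eval_multiset_prod]

lemma HasLead.tendsto {f : ℍ → ℂ} {N : ℕ} {s : ℂ} (hf : HasLead f N s) :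
    ∃ C : ℂ, C ≠ 0 ∧ Tendsto (fun τ ↦ f τ * qp τ ^ N) atImInfty (𝓝 C) := by
  obtain ⟨C, hC, h⟩ := hf
  refine ⟨C, hC, ?_⟩
  have h1 := h.isBigO.trans_tendsto tendsto_qp
  simpa using h1.add (((tendsto_const_nhds (x := (1 : ℂ))).add
    (tendsto_qp.const_mul s)).const_mul C)

lemma HasLead.isBigO {f : ℍ → ℂ} {N : ℕ} {s : ℂ} (hf : HasLead f N s) :
    f =O[atImInfty] fun τ ↦ ((qp τ)⁻¹) ^ N := by
  obtain ⟨C, hC, h⟩ := hf.tendsto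
  refine ((h.isBigO_one ℂ).mul (isBigO_refl (fun τ ↦ ((qp τ)⁻¹) ^ N) _)).congr
    (fun τ ↦ ?_) fun τ ↦ by simp
  rw [mul_assoc, ← mul_pow, mul_inv_cancel₀ (qp_ne_zero τ), one_pow, mul_one]

lemma HasLead.le {f : ℍ → ℂ} {N M : ℕ} {s t : ℂ} (hf : HasLead f N s) (hg : HasLead f M t) :
    N ≤ M := by
  by_contra! hlt
  obtain ⟨C, hC, h⟩ := hf.tendsto
  obtain ⟨C', hC', h'⟩ := hg.tendsto
  have h2 := h'.mul (qp_pow_tendsto (N - M) (by lia))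
  rw [mul_zero] at h2
  refine hC (tendsto_nhds_unique h (h2.congr fun τ ↦ ?_))
  rw [mul_assoc, ← pow_add]
  congr 2
  lia

lemma HasLead.unique {f : ℍ → ℂ} {N M : ℕ} {s t : ℂ} (hf : HasLead f N s) (hg : HasLead f M t) :
    s = t := by
  obtain rfl := (hf.le hg).antisymm (hg.le hf)
  obtain ⟨C, hC, h⟩ := hf
  obtain ⟨C', hC', h'⟩ := hg
  have lim (C s : ℂ) : Tendsto (fun τ ↦ C * (1 + s * qp τ)) atImInfty (𝓝 C) := by
    simpa using ((tendsto_const_nhds (x := (1 : ℂ))).add (tendsto_qp.const_mul s)).const_mul C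
  have h1 := (h.isBigO.trans_tendsto tendsto_qp).add (lim C s)
  have h2 := (h'.isBigO.trans_tendsto tendsto_qp).add (lim C' t)
  obtain rfl : C = C' := by
    rw [zero_add] at h1 h2
    refine tendsto_nhds_unique h1 (h2.congr fun τ ↦ ?_)
    ring
  have h3 : (fun τ ↦ C * (s - t) * qp τ) =o[atImInfty] qp :=
    (h'.sub h).congr_left fun τ ↦ by ring
  by_contra hst
  have hne : C * (s - t) ≠ 0 := mul_ne_zero hC (sub_ne_zero.mpr hst)
  have h4 := (isLittleO_const_mul_left_iff hne).mp h3
  exact isLittleO_irrefl (Frequently.of_forall qp_ne_zero) h4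

/-- The parameter `exp (2πi a τ / d)`. -/
noncomputable def heckeParam (a d : ℕ) (τ : ℍ) : ℂ :=
  Complex.exp (2 * Real.pi * Complex.I * (a * τ / d))

lemma heckeParam_ne_zero (a d : ℕ) (τ : ℍ) : heckeParam a d τ ≠ 0 := Complex.exp_ne_zero _

lemma heckeParam_pow (a : ℕ) {d : ℕ} (hd : d ≠ 0) (τ : ℍ) : heckeParam a d τ ^ d = qp τ ^ a := by
  rw [heckeParam, qp, Function.Periodic.qParam, ← Complex.exp_nat_mul, ← Complex.exp_nat_mul]
  congr 1
  have : (d : ℂ) ≠ 0 := by exact_mod_cast hd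
  field_simp
  simp

lemma heckeParam_self {d : ℕ} (hd : d ≠ 0) (τ : ℍ) : heckeParam d d τ = qp τ := by
  rw [heckeParam, qp, Function.Periodic.qParam]
  congr 1
  have : (d : ℂ) ≠ 0 := by exact_mod_cast hd
  field_simp
  simp

/-- The representative with rows `(a, b)` and `(0, d)`. -/
def upperMat (a b d : ℕ) : Matrix (Fin 2) (Fin 2) ℤ := !![(a : ℤ), b; 0, d]

lemma upperMat_det_pos {a d : ℕ} (ha : a ≠ 0) (hd : d ≠ 0) (b : ℕ) : 0 < (upperMat a b d).det := by
  rw [upperMat, Matrix.det_fin_two_of]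
  simp only [mul_zero, sub_zero]
  positivity

lemma coe_upperMat_smul {a d : ℕ} (ha : a ≠ 0) (hd : d ≠ 0) (b : ℕ) (τ : ℍ) :
    ((mob (upperMat a b d) • τ : ℍ) : ℂ) = (a * τ + b) / d := by
  rw [coe_mob_smul (upperMat_det_pos ha hd b)]
  simp [upperMat]

lemma qp_upperMat_smul {a d : ℕ} (ha : a ≠ 0) (hd : d ≠ 0) (b : ℕ) (τ : ℍ) :
    qp (mob (upperMat a b d) • τ) =
      Complex.exp (2 * Real.pi * Complex.I / d) ^ b * heckeParam a d τ := by
  rw [heckeParam, qp, Function.Periodic.qParam, coe_upperMat_smul ha hd, ← Complex.exp_nat_mul,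
    ← Complex.exp_add]
  congr 1
  have : (d : ℂ) ≠ 0 := by exact_mod_cast hd
  field_simp
  push_cast
  ring

lemma tendsto_upperMat_smul {a d : ℕ} (ha : a ≠ 0) (hd : d ≠ 0) (b : ℕ) :
    Tendsto (fun τ ↦ mob (upperMat a b d) • τ) atImInfty atImInfty := by
  have h (τ : ℍ) : (mob (upperMat a b d) • τ).im = (a / d : ℝ) * τ.im := by
    have := congrArg Complex.im (coe_upperMat_smul ha hd b τ)
    rw [Complex.div_natCast_im] at this
    simp at this
    rw [this]
    ring
  rw [atImInfty, tendsto_comap_iff]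
  refine Tendsto.congr (fun τ ↦ (h τ).symm) (tendsto_comap.const_mul_atTop ?_)
  positivity

lemma jH_sub_jH_mob_sub_tendsto {a d : ℕ} (ha : a ≠ 0) (hd : d ≠ 0) (b : ℕ) :
    Tendsto (fun τ ↦ jH τ - jH (mob (upperMat a b d) • τ) - ((qp τ)⁻¹ -
      (Complex.exp (2 * Real.pi * Complex.I / d) ^ b * heckeParam a d τ)⁻¹)) atImInfty (𝓝 0) := by
  have h : Tendsto (fun τ ↦ jH τ - (qp τ)⁻¹ - 744) atImInfty (𝓝 0) :=
    jH_isBigO.trans_tendsto tendsto_qp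
  have h' := h.sub (h.comp (tendsto_upperMat_smul ha hd b))
  rw [sub_zero] at h'
  refine h'.congr fun τ ↦ ?_
  simp only [Function.comp_apply, qp_upperMat_smul ha hd]
  ring

lemma prod_one_sub_pow_mul {ζ : ℂ} {d : ℕ} (hζ : IsPrimitiveRoot ζ d) (hd : d ≠ 0) (x : ℂ) :
    ∏ b ∈ Finset.range d, (1 - ζ ^ b * x) = 1 - x ^ d := by
  have := congrArg (Polynomial.eval 1)
    (X_pow_sub_C_eq_prod hζ (Nat.pos_of_ne_zero hd) (rfl : x ^ d = x ^ d))
  simpa [Polynomial.eval_prod] using this.symm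

lemma isLittleO_qp_pow_sub (m : ℕ) (hm : m ≠ 0) :
    (fun τ ↦ 1 - qp τ ^ m - (1 + (if m = 1 then -1 else 0) * qp τ)) =o[atImInfty] qp := by
  split_ifs with h
  · subst h
    exact (isLittleO_zero _ _).congr_left fun τ ↦ by ring
  · have h1 := (isLittleO_pow_pow (𝕜 := ℂ) (m := 1) (n := m) (by lia)).comp_tendsto tendsto_qp
    have h2 := h1.neg_left
    refine h2.congr (fun τ ↦ ?_) fun τ ↦ by simp
    simp

lemma hasLead_of_isLittleO {f A : ℍ → ℂ} {N : ℕ} {s κ : ℂ} (hκ : κ ≠ 0)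
    (h : (fun τ ↦ κ * (f τ * qp τ ^ N) - A τ) =o[atImInfty] qp)
    (hA : (fun τ ↦ A τ - (1 + s * qp τ)) =o[atImInfty] qp) : HasLead f N s := by
  refine ⟨κ⁻¹, inv_ne_zero hκ, ((h.add hA).const_mul_left κ⁻¹).congr_left fun τ ↦ ?_⟩
  field_simp
  ring

lemma isBigO_one_sub_mul {y : ℍ → ℂ} (hy : y =o[atImInfty] (1 : ℍ → ℂ)) (c : ℂ) :
    (fun τ ↦ 1 - c * y τ) =O[atImInfty] (1 : ℍ → ℂ) :=
  (isBigO_refl (1 : ℍ → ℂ) _).sub (hy.isBigO.const_mul_left c)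

lemma hasLead_hecke_of_lt {a d : ℕ} (hd : d ≠ 0) (hda : d < a) :
    HasLead (fun τ ↦ ∏ b ∈ Finset.range d, (jH τ - jH (mob (upperMat a b d) • τ))) a
      (if a - d = 1 then -1 else 0) := by
  have ha : a ≠ 0 := by lia
  set ζ := Complex.exp (2 * Real.pi * Complex.I / d) with hζdef
  have hζ : IsPrimitiveRoot ζ d := Complex.isPrimitiveRoot_exp d hd
  have hζ0 : ζ ≠ 0 := Complex.exp_ne_zero _
  have hY : heckeParam a d =o[atImInfty] qp := by
    refine IsLittleO.of_pow (n := d) ?_ hd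
    refine ((isLittleO_pow_pow (𝕜 := ℂ) hda).comp_tendsto tendsto_qp).congr (fun τ ↦ ?_) fun τ ↦ rfl
    simp [heckeParam_pow a hd]
  have hY' : (fun τ ↦ heckeParam a d τ * (qp τ)⁻¹) =o[atImInfty] (1 : ℍ → ℂ) :=
    (hY.mul_isBigO (isBigO_refl (fun τ ↦ (qp τ)⁻¹) _)).congr (fun τ ↦ rfl)
      fun τ ↦ by simp [qp_ne_zero]
  have key := isLittleO_prod_sub_prod (Finset.range d)
    (F := fun b τ ↦ -(ζ ^ b * heckeParam a d τ) * (jH τ - jH (mob (upperMat a b d) • τ)))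
    (A := fun b τ ↦ 1 - ζ ^ b * (heckeParam a d τ * (qp τ)⁻¹)) (fun b _ ↦ by
      refine ((hY.const_mul_left (-ζ ^ b)).mul_isBigO
        ((jH_sub_jH_mob_sub_tendsto ha hd b).isBigO_one ℂ)).congr (fun τ ↦ ?_) fun τ ↦ by simp
      have := heckeParam_ne_zero a d τ
      have := qp_ne_zero τ
      have := pow_ne_zero b hζ0
      rw [← hζdef]
      field_simp
      ring) fun b _ ↦ isBigO_one_sub_mul hY' _
  refine hasLead_of_isLittleO (κ := ∏ b ∈ Finset.range d, -ζ ^ b)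
    (Finset.prod_ne_zero_iff.mpr fun b _ ↦ neg_ne_zero.mpr (pow_ne_zero b hζ0))
    (key.congr_left fun τ ↦ ?_) (isLittleO_qp_pow_sub (a - d) (by lia))
  congr 1
  · rw [← heckeParam_pow a hd, mul_comm (∏ b ∈ _, _) (heckeParam a d τ ^ d), ← mul_assoc,
      Finset.prod_mul_distrib]
    congr 1
    simp only [← neg_mul]
    rw [Finset.prod_mul_distrib, Finset.prod_const, Finset.card_range, mul_comm]
  · rw [prod_one_sub_pow_mul hζ hd, mul_pow, heckeParam_pow a hd, inv_pow,
      ← pow_sub₀ _ (qp_ne_zero τ) hda.le]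

lemma hasLead_hecke_of_gt {a d : ℕ} (ha : a ≠ 0) (had : a < d) :
    HasLead (fun τ ↦ ∏ b ∈ Finset.range d, (jH τ - jH (mob (upperMat a b d) • τ))) d
      (if d - a = 1 then -1 else 0) := by
  have hd : d ≠ 0 := by lia
  set ζ := Complex.exp (2 * Real.pi * Complex.I / d) with hζdef
  have hζ : IsPrimitiveRoot ζ d := Complex.isPrimitiveRoot_exp d hd
  have hζ0 : ζ ≠ 0 := Complex.exp_ne_zero _
  have hY : qp =o[atImInfty] heckeParam a d := by
    refine IsLittleO.of_pow (n := d) ?_ hd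
    refine ((isLittleO_pow_pow (𝕜 := ℂ) had).comp_tendsto tendsto_qp).congr (fun τ ↦ rfl) fun τ ↦ ?_
    simp [heckeParam_pow a hd]
  have hY' : (fun τ ↦ qp τ * (heckeParam a d τ)⁻¹) =o[atImInfty] (1 : ℍ → ℂ) :=
    (hY.mul_isBigO (isBigO_refl (fun τ ↦ (heckeParam a d τ)⁻¹) _)).congr (fun τ ↦ rfl)
      fun τ ↦ by simp [heckeParam_ne_zero]
  have key := isLittleO_prod_sub_prod (Finset.range d)
    (F := fun b τ ↦ qp τ * (jH τ - jH (mob (upperMat a b d) • τ)))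
    (A := fun b τ ↦ 1 - ζ⁻¹ ^ b * (qp τ * (heckeParam a d τ)⁻¹)) (fun b _ ↦ by
      refine ((isBigO_refl qp _).mul_isLittleO
        ((isLittleO_one_iff ℂ).mpr (jH_sub_jH_mob_sub_tendsto ha hd b))).congr
        (fun τ ↦ ?_) fun τ ↦ by simp
      have := heckeParam_ne_zero a d τ
      have := qp_ne_zero τ
      have := pow_ne_zero b hζ0
      rw [← hζdef, inv_pow]
      field_simp) fun b _ ↦ isBigO_one_sub_mul hY' _
  refine hasLead_of_isLittleO one_ne_zero (key.congr_left fun τ ↦ ?_)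
    (isLittleO_qp_pow_sub (d - a) (by lia))
  congr 1
  · rw [Finset.prod_mul_distrib, Finset.prod_const, Finset.card_range]
    ring
  · rw [prod_one_sub_pow_mul hζ.inv hd, mul_pow, inv_pow, heckeParam_pow a hd,
      ← pow_sub₀ _ (qp_ne_zero τ) had.le]

lemma hasLead_hecke_self {d : ℕ} (hd : d ≠ 0) :
    HasLead (fun τ ↦ ∏ b ∈ (Finset.range d).erase 0, (jH τ - jH (mob (upperMat d b d) • τ)))
      ((Finset.range d).erase 0).card 0 := by
  set ζ := Complex.exp (2 * Real.pi * Complex.I / d) with hζdef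
  have hζ : IsPrimitiveRoot ζ d := Complex.isPrimitiveRoot_exp d hd
  have hζ0 : ζ ≠ 0 := Complex.exp_ne_zero _
  have key := isLittleO_prod_sub_prod ((Finset.range d).erase 0)
    (F := fun b τ ↦ qp τ * (jH τ - jH (mob (upperMat d b d) • τ)))
    (A := fun b τ ↦ 1 - ζ⁻¹ ^ b) (fun b _ ↦ by
      refine ((isBigO_refl qp _).mul_isLittleO
        ((isLittleO_one_iff ℂ).mpr (jH_sub_jH_mob_sub_tendsto hd hd b))).congr
        (fun τ ↦ ?_) fun τ ↦ by simp
      have := qp_ne_zero τ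
      have := pow_ne_zero b hζ0
      rw [← hζdef, inv_pow, heckeParam_self hd]
      field_simp) fun b _ ↦ isBigO_const_const _ one_ne_zero _
  have hne : ∏ b ∈ (Finset.range d).erase 0, (1 - ζ⁻¹ ^ b) ≠ 0 := by
    refine Finset.prod_ne_zero_iff.mpr fun b hb ↦ sub_ne_zero.mpr fun h ↦ ?_
    rw [Finset.mem_erase, Finset.mem_range] at hb
    exact hζ.inv.pow_ne_one_of_pos_of_lt hb.1 hb.2 h.symm
  refine ⟨_, hne, key.congr_left fun τ ↦ ?_⟩
  rw [Finset.prod_mul_distrib, Finset.prod_const]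
  ring

lemma card_filter_divisors (n : ℕ) (hn : n ≠ 0) :
    ({d ∈ n.divisors | n / d = d + 1 ∨ d = n / d + 1} : Finset ℕ).card =
      if IsSquare (4 * (n : ℤ) + 1) then 2 else 0 := by
  split_ifs with h
  · obtain ⟨k, hk⟩ := h
    obtain ⟨m, hm⟩ : ∃ m : ℕ, n = m * (m + 1) := by
      obtain ⟨l, hl⟩ : ∃ l : ℕ, 4 * n + 1 = l * l := ⟨k.natAbs, by zify; simpa using hk⟩
      obtain ⟨m, rfl | rfl⟩ := Nat.even_or_odd' l
      · exfalso
        have : 2 * m * (2 * m) = 4 * (m * m) := by ring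
        lia
      · exact ⟨m, by linarith⟩
    have hm0 : 0 < m := by
      rw [Nat.pos_iff_ne_zero]
      rintro rfl
      simp_all
    have : ({d ∈ n.divisors | n / d = d + 1 ∨ d = n / d + 1} : Finset ℕ) = {m, m + 1} := by
      ext d
      simp only [Finset.mem_filter, Nat.mem_divisors, Finset.mem_insert, Finset.mem_singleton]
      constructor
      · rintro ⟨⟨hd, -⟩, h⟩
        have h1 := Nat.div_mul_cancel hd
        rcases h with h | h
        · rw [h, hm] at h1
          left; nlinarith
        · generalize n / d = e at *
          rw [h, hm] at h1
          right; nlinarith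
      · rintro (rfl | rfl)
        · exact ⟨⟨hm ▸ dvd_mul_right _ _, hn⟩, .inl (by rw [hm, Nat.mul_div_cancel_left _ hm0])⟩
        · exact ⟨⟨hm ▸ dvd_mul_left _ _, hn⟩, .inr (by rw [hm, Nat.mul_div_cancel _ (by lia)])⟩
    rw [this, Finset.card_pair (by lia)]
  · rw [Finset.card_eq_zero, Finset.filter_eq_empty_iff]
    intro d hd h'
    have h1 := Nat.div_mul_cancel (Nat.mem_divisors.mp hd).1
    refine h ?_
    rcases h' with h' | h'
    · rw [h'] at h1
      exact ⟨2 * d + 1, by rw [← h1]; push_cast; ring⟩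
    · generalize n / d = e at *
      rw [h'] at h1
      exact ⟨2 * e + 1, by rw [← h1]; push_cast; ring⟩

lemma hasLead_heckeSet_fiber {n d : ℕ} (hd : d ∈ n.divisors) :
    ∃ N, HasLead (fun τ ↦ ∏ b ∈ Finset.range d with ¬(d * d = n ∧ b = 0),
      (jH τ - jH (mob (heckeMat n ⟨d, b⟩) • τ))) N
      (if n / d = d + 1 ∨ d = n / d + 1 then -1 else 0) := by
  rw [Nat.mem_divisors] at hd
  have hd0 : d ≠ 0 := fun h ↦ hd.2 (by simpa [h] using hd.1)
  obtain ⟨a, rfl⟩ := hd.1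
  have ha0 : a ≠ 0 := fun h ↦ hd.2 (by simp [h])
  have hdiv : d * a / d = a := Nat.mul_div_cancel_left _ (Nat.pos_of_ne_zero hd0)
  have hmat (b : ℕ) : heckeMat (d * a) ⟨d, b⟩ = upperMat a b d := by
    simp only [heckeMat, hdiv, upperMat]
  simp only [hmat, hdiv]
  rcases lt_trichotomy a d with h | rfl | h
  · refine ⟨d, ?_⟩
    have hf : ({b ∈ Finset.range d | ¬(d * d = d * a ∧ b = 0)} : Finset ℕ) = Finset.range d :=
      Finset.filter_true_of_mem fun b _ hb ↦ h.ne'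
        (Nat.eq_of_mul_eq_mul_left (Nat.pos_of_ne_zero hd0) hb.1)
    rw [hf]
    simp only [show (a = d + 1 ∨ d = a + 1) ↔ d - a = 1 by lia]
    exact hasLead_hecke_of_gt ha0 h
  · have : ({b ∈ Finset.range a | ¬(a * a = a * a ∧ b = 0)} : Finset ℕ) =
        (Finset.range a).erase 0 := by
      ext b
      simp [and_comm]
    rw [this, if_neg (by lia)]
    exact ⟨_, hasLead_hecke_self hd0⟩
  · refine ⟨a, ?_⟩
    have hf : ({b ∈ Finset.range d | ¬(d * d = d * a ∧ b = 0)} : Finset ℕ) = Finset.range d :=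
      Finset.filter_true_of_mem fun b _ hb ↦ h.ne
        (Nat.eq_of_mul_eq_mul_left (Nat.pos_of_ne_zero hd0) hb.1)
    rw [hf]
    simp only [show (a = d + 1 ∨ d = a + 1) ↔ a - d = 1 by lia]
    exact hasLead_hecke_of_lt hd0 h

lemma hasLead_modProd {n : ℕ} (hn : n ≠ 0) :
    ∃ N, HasLead (modProd n) N (if IsSquare (4 * (n : ℤ) + 1) then -2 else 0) := by
  classical
  choose! N hN using fun d (hd : d ∈ n.divisors) ↦ hasLead_heckeSet_fiber hd
  refine ⟨∑ d ∈ n.divisors, N d, ?_⟩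
  have h := HasLead.prod _ hN
  rw [← Finset.sum_filter, Finset.sum_const, card_filter_divisors n hn] at h
  convert h using 2 with τ
  · simp only [modProd, heckeSet', heckeSet, Finset.prod_filter, Finset.prod_sigma]
  · split_ifs <;> norm_num

/-- The modular polynomial of level `n` on the diagonal, with the trace of its roots. -/
theorem exists_modProd_eq_eval {n : ℕ} (hn : n ≠ 0) : ∃ p : Polynomial ℂ, p ≠ 0 ∧
    (∀ τ, modProd n τ = p.eval (jH τ)) ∧
    (p.roots.map fun x ↦ x - 744).sum = if IsSquare (4 * (n : ℤ) + 1) then 2 else 0 := by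
  obtain ⟨N, hN⟩ := hasLead_modProd hn
  obtain ⟨p, hp⟩ := exists_polynomial N (modProd n) (mdiff_modProd n) (modProd_smul n) hN.isBigO
  have hp0 : p ≠ 0 := by
    rintro rfl
    obtain ⟨C, hC, h⟩ := hN.tendsto
    exact hC (tendsto_nhds_unique h (by simp [hp]))
  refine ⟨p, hp0, hp, ?_⟩
  have h := hasLead_eval_jH hp0
  rw [← funext hp] at h
  have := congrArg (- ·) (h.unique hN)
  simp only [← Multiset.sum_map_neg] at this
  simp only [neg_sub] at this
  rw [this]
  split_ifs <;> norm_num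

lemma exists_formRoot_eq {d : ℤ} (hd : 0 < d) {Q : ℤ × ℤ × ℤ} (hQ : IsForm d Q) :
    ∃ τ : ℍ, formRoot Q = τ := by
  obtain ⟨ha, hdisc⟩ := hQ
  have hpos : (0 : ℝ) < ((4 * Q.1 * Q.2.2 - Q.2.1 ^ 2 : ℤ) : ℝ) := by exact_mod_cast by linarith
  have ha' : (0 : ℝ) < Q.1 := by exact_mod_cast ha
  refine ⟨⟨formRoot Q, ?_⟩, rfl⟩
  have : (formRoot Q).im = √((4 * Q.1 * Q.2.2 - Q.2.1 ^ 2 : ℤ) : ℝ) / (2 * Q.1) := by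
    have h2 : (2 * (Q.1 : ℂ)) = ((2 * Q.1 : ℝ) : ℂ) := by push_cast; rfl
    rw [formRoot, h2, Complex.div_ofReal_im]
    simp
  rw [this]
  exact div_pos (Real.sqrt_pos.mpr hpos) (by positivity)

lemma formRoot_eval {d : ℤ} (hd : 0 < d) {Q : ℤ × ℤ × ℤ} (hQ : IsForm d Q) :
    (Q.1 : ℂ) * formRoot Q ^ 2 + Q.2.1 * formRoot Q + Q.2.2 = 0 := by
  obtain ⟨ha, hdisc⟩ := hQ
  have hpos : (0 : ℝ) ≤ ((4 * Q.1 * Q.2.2 - Q.2.1 ^ 2 : ℤ) : ℝ) := by exact_mod_cast by linarith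
  have ha' : (Q.1 : ℂ) ≠ 0 := by exact_mod_cast ha.ne'
  have hs : ((√((4 * Q.1 * Q.2.2 - Q.2.1 ^ 2 : ℤ) : ℝ) : ℝ) : ℂ) ^ 2 =
      4 * Q.1 * Q.2.2 - Q.2.1 ^ 2 := by
    rw [← Complex.ofReal_pow, Real.sq_sqrt hpos]
    push_cast
    rfl
  rw [formRoot]
  generalize ((√((4 * Q.1 * Q.2.2 - Q.2.1 ^ 2 : ℤ) : ℝ) : ℝ) : ℂ) = s at *
  field_simp
  linear_combination Complex.I ^ 2 * hs + (4 * Q.1 * Q.2.2 - Q.2.1 ^ 2 : ℂ) * Complex.I_sq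

/-- A positive definite form is determined by its discriminant and its root. -/
lemma form_eq_of_root {d : ℤ} (hd : 0 < d) {Q Q' : ℤ × ℤ × ℤ} (hQ : IsForm d Q)
    (hQ' : IsForm d Q') {τ : ℍ} (h : (Q.1 : ℂ) * τ ^ 2 + Q.2.1 * τ + Q.2.2 = 0)
    (h' : (Q'.1 : ℂ) * τ ^ 2 + Q'.2.1 * τ + Q'.2.2 = 0) : Q = Q' := by
  obtain ⟨a, b, c⟩ := Q
  obtain ⟨a', b', c'⟩ := Q'
  obtain ⟨ha, hdisc⟩ := hQ
  obtain ⟨ha', hdisc'⟩ := hQ'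
  simp only at *
  obtain ⟨h1, h2⟩ := int_mul_add_eq_zero (τ := τ) (s := a' * b - a * b') (t := a' * c - a * c') (by
    push_cast
    linear_combination a' * h - a * h')
  have hb : a' * b = a * b' := by linarith
  have hc : a' * c = a * c' := by linarith
  have hsq : d * (a' ^ 2 - a ^ 2) = 0 := by
    linear_combination a' ^ 2 * hdisc - a ^ 2 * hdisc' - (a' * b + a * b') * hb + 4 * a * a' * hc
  have haa : a' = a := by
    have h0 := (mul_eq_zero.mp hsq).resolve_left hd.ne'
    have : (a' - a) * (a' + a) = 0 := by linear_combination h0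
    rcases mul_eq_zero.mp this with h | h <;> lia
  subst haa
  rw [mul_left_cancel₀ ha.ne' hb, mul_left_cancel₀ ha.ne' hc]

lemma formRoot_eq_iff {d : ℤ} (hd : 0 < d) {Q : ℤ × ℤ × ℤ} (hQ : IsForm d Q) (τ : ℍ) :
    formRoot Q = τ ↔ (Q.1 : ℂ) * τ ^ 2 + Q.2.1 * τ + Q.2.2 = 0 := by
  refine ⟨fun h ↦ h ▸ formRoot_eval hd hQ, fun h ↦ ?_⟩
  obtain ⟨σ, hσ⟩ := exists_formRoot_eq hd hQ
  have h' := formRoot_eval hd hQ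
  rw [hσ] at h' ⊢
  have ha : (Q.1 : ℂ) ≠ 0 := by exact_mod_cast hQ.1.ne'
  have h1 : ((σ : ℂ) - τ) * (Q.1 * (σ + τ) + Q.2.1) = 0 := by linear_combination h' - h
  refine sub_eq_zero.mp ((mul_eq_zero.mp h1).resolve_right fun h2 ↦ ?_)
  have h3 := congrArg Complex.im h2
  have := σ.im_pos
  have := τ.im_pos
  have ha' : (0 : ℝ) < Q.1 := by exact_mod_cast hQ.1
  simp at h3
  rcases h3 with h3 | h3 <;> [exact hQ.1.ne' h3; linarith]

/-- Integral matrices of determinant `n` fixing `τ`. -/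
def fixSet (n : ℕ) (τ : ℍ) : Set (Matrix (Fin 2) (Fin 2) ℤ) := {A | A.det = n ∧ mob A • τ = τ}

/-- The traces `r` for which `τ` is the root of a form of discriminant `r ^ 2 - 4 * n`. -/
def traceSet (n : ℕ) (τ : ℍ) : Set ℤ :=
  {r | r ^ 2 < 4 * (n : ℤ) ∧ ∃ Q, IsForm (4 * n - r ^ 2) Q ∧ formRoot Q = τ}

lemma traceSet_finite (n : ℕ) (τ : ℍ) : (traceSet n τ).Finite := by
  refine (Set.finite_Icc (-(4 * n : ℤ)) (4 * n)).subset fun r hr ↦ ?_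
  have := hr.1
  exact ⟨by nlinarith, by nlinarith⟩

/-- The matrices in `fixSet n τ` with positive lower left entry. -/
def fixPos (n : ℕ) (τ : ℍ) : Set (Matrix (Fin 2) (Fin 2) ℤ) := {A ∈ fixSet n τ | 0 < A 1 0}

lemma mem_fixSet_iff {n : ℕ} (hn : n ≠ 0) {τ : ℍ} {A : Matrix (Fin 2) (Fin 2) ℤ} :
    A ∈ fixSet n τ ↔ A 0 0 * A 1 1 - A 0 1 * A 1 0 = n ∧
      (A 1 0 : ℂ) * τ ^ 2 + (A 1 1 - A 0 0 : ℤ) * τ + (- A 0 1 : ℤ) = 0 := by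
  unfold fixSet
  rw [Set.mem_ofPred_eq, ← Matrix.det_fin_two]
  refine and_congr_right fun h ↦ ?_
  rw [mob_smul_eq_self_iff (by rw [h]; positivity)]
  push_cast
  constructor <;> intro h <;> linear_combination -h

lemma isForm_of_mem_fixPos {n : ℕ} (hn : n ≠ 0) {τ : ℍ} {A : Matrix (Fin 2) (Fin 2) ℤ}
    (hA : A ∈ fixPos n τ) :
    IsForm (4 * n - (A 0 0 + A 1 1) ^ 2) (A 1 0, A 1 1 - A 0 0, - A 0 1) := by
  obtain ⟨h1, h2⟩ := (mem_fixSet_iff hn).mp hA.1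
  exact ⟨hA.2, by linear_combination -4 * h1⟩

lemma disc_pos_of_root {d : ℤ} {Q : ℤ × ℤ × ℤ} (hQ : IsForm d Q) {τ : ℍ}
    (h : (Q.1 : ℂ) * τ ^ 2 + Q.2.1 * τ + Q.2.2 = 0) : 0 < d := by
  have h1 := congrArg Complex.im h
  have h2 := congrArg Complex.re h
  have ha' : (0 : ℝ) < Q.1 := by exact_mod_cast hQ.1
  have hτ := τ.im_pos
  simp [pow_two] at h1 h2
  have h3 : 2 * Q.1 * τ.re + Q.2.1 = 0 := by
    refine (mul_eq_zero.mp (?_ : τ.im * _ = 0)).resolve_left hτ.ne'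
    linear_combination h1
  have h4 : (d : ℝ) = (2 * Q.1 * τ.im) ^ 2 := by
    have : (Q.2.1 ^ 2 - 4 * Q.1 * Q.2.2 : ℝ) = -d := by exact_mod_cast hQ.2
    linear_combination this - (Q.2.1 + 2 * Q.1 * τ.re) * h3 + 4 * Q.1 * h2
  have : (0 : ℝ) < d := by rw [h4]; positivity
  exact_mod_cast this

lemma bijOn_trace {n : ℕ} (hn : n ≠ 0) (τ : ℍ) :
    Set.BijOn (fun A : Matrix (Fin 2) (Fin 2) ℤ ↦ A 0 0 + A 1 1) (fixPos n τ) (traceSet n τ) := by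
  refine ⟨fun A hA ↦ ?_, fun A hA B hB h ↦ ?_, fun r hr ↦ ?_⟩
  · have hQ := isForm_of_mem_fixPos hn hA
    have hroot := ((mem_fixSet_iff hn).mp hA.1).2
    have hd := disc_pos_of_root hQ hroot
    exact ⟨by linarith, _, hQ, (formRoot_eq_iff hd hQ τ).mpr hroot⟩
  · have hQ := isForm_of_mem_fixPos hn hA
    have hQ' := isForm_of_mem_fixPos hn hB
    have hroot := ((mem_fixSet_iff hn).mp hA.1).2
    have hroot' := ((mem_fixSet_iff hn).mp hB.1).2
    simp only at h
    rw [← h] at hQ'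
    have := form_eq_of_root (disc_pos_of_root hQ hroot) hQ hQ' hroot hroot'
    simp only [Prod.mk.injEq] at this
    ext i j
    fin_cases i <;> fin_cases j <;> simp <;> lia
  · obtain ⟨hr, ⟨a, b, c⟩, hQ, hroot⟩ := hr
    rw [formRoot_eq_iff (by linarith) hQ] at hroot
    obtain ⟨ha, hdisc⟩ := hQ
    simp only at ha hdisc hroot
    have hpar : (r - b) % 2 = 0 := by
      have : Even ((r - b) * (r + b)) := ⟨2 * (n - a * c), by linear_combination -hdisc⟩
      rcases Int.even_mul.mp this with h | h
      · exact Int.even_iff.mp h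
      · rw [Int.even_iff] at h; lia
    obtain ⟨α, hα⟩ : ∃ α, r - b = 2 * α := ⟨(r - b) / 2, by lia⟩
    refine ⟨!![α, -c; a, r - α], ⟨(mem_fixSet_iff hn).mpr ⟨?_, ?_⟩, ?_⟩, by simp⟩
    · obtain rfl : b = r - 2 * α := by linarith
      simp only [Matrix.of_apply, Matrix.cons_val', Matrix.cons_val_zero, Matrix.cons_val_one,
        Matrix.cons_val_fin_one]
      linarith
    · obtain rfl : b = r - 2 * α := by linarith
      simp only [Matrix.of_apply, Matrix.cons_val', Matrix.cons_val_zero, Matrix.cons_val_one,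
        Matrix.cons_val_fin_one]
      rw [show r - α - α = r - 2 * α by ring, neg_neg]
      exact hroot
    · simpa using ha

lemma fixSet_eq_union {n : ℕ} (hn : n ≠ 0) (τ : ℍ) :
    fixSet n τ = (fixPos n τ ∪ Neg.neg '' fixPos n τ) ∪
      {A | ∃ k : ℤ, k ^ 2 = n ∧ A = k • (1 : Matrix (Fin 2) (Fin 2) ℤ)} := by
  have hneg {A : Matrix (Fin 2) (Fin 2) ℤ} (hA : A ∈ fixSet n τ) : -A ∈ fixSet n τ := by
    rw [mem_fixSet_iff hn] at hA ⊢
    simp only [Matrix.neg_apply]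
    refine ⟨by linear_combination hA.1, ?_⟩
    have := hA.2
    push_cast at this ⊢
    linear_combination -this
  ext A
  simp only [Set.mem_union, Set.mem_image, Set.mem_ofPred_eq]
  constructor
  · intro hA
    rcases lt_trichotomy (A 1 0) 0 with h | h | h
    · exact .inl (.inr ⟨-A, ⟨hneg hA, by simpa using h⟩, neg_neg A⟩)
    · obtain ⟨h1, h2⟩ := (mem_fixSet_iff hn).mp hA
      rw [h] at h1 h2
      obtain ⟨h3, h4⟩ := int_mul_add_eq_zero (τ := τ) (s := A 1 1 - A 0 0) (t := - A 0 1) (by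
        linear_combination h2)
      have h5 : A 1 1 = A 0 0 := by linarith
      refine .inr ⟨A 0 0, by rw [h5] at h1; linear_combination h1, ?_⟩
      ext i j
      fin_cases i <;> fin_cases j <;> simp <;> lia
    · exact .inl (.inl ⟨hA, h⟩)
  · rintro ((h | ⟨B, hB, rfl⟩) | ⟨k, hk, rfl⟩)
    · exact h.1
    · exact hneg hB.1
    · rw [mem_fixSet_iff hn]
      exact ⟨by simp [← hk, pow_two], by simp⟩

lemma ncard_sq_roots {n : ℕ} (hn : n ≠ 0) {β : Type*} (S : Set β) (f : ℤ → β)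
    (hf : f.Injective) (hS : S = {b | ∃ k : ℤ, k ^ 2 = n ∧ b = f k}) :
    S.Finite ∧ S.ncard = if IsSquare (n : ℤ) then 2 else 0 := by
  split_ifs with h
  · obtain ⟨m, hm⟩ := h
    have hm0 : m ≠ 0 := by
      rintro rfl
      exact hn (by exact_mod_cast hm)
    have : S = {f m, f (-m)} := by
      rw [hS]
      ext b
      simp only [Set.mem_ofPred_eq, Set.mem_insert_iff, Set.mem_singleton_iff]
      constructor
      · rintro ⟨k, hk, rfl⟩
        rw [hm, ← pow_two] at hk
        rcases sq_eq_sq_iff_eq_or_eq_neg.mp hk with rfl | rfl <;> simp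
      · rintro (rfl | rfl)
        · exact ⟨m, by rw [hm, pow_two], rfl⟩
        · exact ⟨-m, by rw [hm, neg_sq, pow_two], rfl⟩
    rw [this]
    exact ⟨Set.toFinite _, Set.ncard_pair fun h ↦ hm0 (by have := hf h; lia)⟩
  · have : S = ∅ := by
      rw [hS]
      refine Set.eq_empty_of_forall_notMem ?_
      rintro b ⟨k, hk, -⟩
      exact h ⟨k, by rw [← hk, pow_two]⟩
    simp [this]

lemma ncard_fixSet {n : ℕ} (hn : n ≠ 0) (τ : ℍ) : (fixSet n τ).ncard =
    2 * (traceSet n τ).ncard + if IsSquare (n : ℤ) then 2 else 0 := by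
  have hb := bijOn_trace hn τ
  have hfin : (fixPos n τ).Finite := hb.finite_iff_finite.mpr (traceSet_finite n τ)
  have hcard : (fixPos n τ).ncard = (traceSet n τ).ncard := by
    rw [← hb.image_eq, hb.injOn.ncard_image]
  obtain ⟨hsf, hsc⟩ := ncard_sq_roots hn _ (fun k : ℤ ↦ k • (1 : Matrix (Fin 2) (Fin 2) ℤ))
    (fun k l h ↦ by simpa using congrFun (congrFun h 0) 0) rfl
  rw [fixSet_eq_union hn, Set.ncard_union_eq _ (hfin.union (hfin.image _)) hsf, hsc,
    Set.ncard_union_eq _ hfin (hfin.image _), Set.ncard_image_of_injective _ neg_injective, hcard,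
    two_mul]
  · rw [Set.disjoint_left]
    rintro A hA ⟨B, hB, rfl⟩
    have h1 := hA.2
    have h2 := hB.2
    simp at h1
    lia
  · rw [Set.disjoint_left]
    rintro A hA ⟨k, -, rfl⟩
    rcases hA with hA | ⟨B, hB, h⟩
    · simpa using hA.2
    · have h1 := hB.2
      have h2 := congrFun (congrFun h 1) 0
      simp at h2
      lia

lemma mob_heckeMat_smul_of_sq {n : ℕ} {x : Σ _ : ℕ, ℕ} (hx : x ∈ heckeSet n)
    (h : x.1 * x.1 = n ∧ x.2 = 0) (τ : ℍ) : mob (heckeMat n x) • τ = τ := by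
  rw [mob_smul_eq_self_iff (heckeMat_det_pos hx), heckeMat_eq_smul_one hx h]
  simp [mul_comm]

open scoped Classical in
lemma card_filter_heckeSet {n : ℕ} (hn : n ≠ 0) (τ : ℍ) :
    ({x ∈ heckeSet n | jH (mob (heckeMat n x) • τ) = jH τ} : Finset _).card =
      (heckeFix n τ).card + if IsSquare (n : ℤ) then 1 else 0 := by
  rw [← Finset.card_filter_add_card_filter_not fun x : Σ _ : ℕ, ℕ ↦ ¬(x.1 * x.1 = n ∧ x.2 = 0),
    heckeFix, heckeSet', Finset.filter_filter, Finset.filter_filter, Finset.filter_filter]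
  congr 1
  · simp only [and_comm]
  · split_ifs with h
    · obtain ⟨m, hm⟩ := h
      replace hm : n = m.natAbs * m.natAbs := by zify; rw [hm, abs_mul_abs_self]
      refine Finset.card_eq_one.mpr ⟨⟨m.natAbs, 0⟩, Finset.ext fun x ↦ ?_⟩
      rw [Finset.mem_filter, Finset.mem_singleton, not_not]
      constructor
      · rintro ⟨-, -, h1, h2⟩
        obtain ⟨x1, x2⟩ := x
        obtain rfl : x2 = 0 := h2
        obtain rfl : x1 = m.natAbs := Nat.mul_self_inj.mp (h1.trans hm)
        rfl
      · rintro rfl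
        have hx : (⟨m.natAbs, 0⟩ : Σ _ : ℕ, ℕ) ∈ heckeSet n :=
          mem_heckeSet.mpr ⟨⟨⟨_, hm⟩, hn⟩,
            Nat.pos_of_ne_zero fun h ↦ hn (by rw [hm, show m.natAbs = 0 from h])⟩
        exact ⟨hx, by rw [mob_heckeMat_smul_of_sq hx ⟨hm.symm, rfl⟩], hm.symm, rfl⟩
    · refine Finset.card_eq_zero.mpr (Finset.filter_eq_empty_iff.mpr ?_)
      rintro x - ⟨-, hx⟩
      exact h ⟨x.1, by exact_mod_cast (not_not.mp hx).1.symm⟩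

lemma ncard_fixSet' {n : ℕ} (hn : n ≠ 0) (τ : ℍ) : (fixSet n τ).ncard =
    2 * ramif (jH τ) * ((heckeFix n τ).card + if IsSquare (n : ℤ) then 1 else 0) := by
  classical
  rw [← card_filter_heckeSet hn]
  set S : Finset (Σ _ : ℕ, ℕ) := {x ∈ heckeSet n | jH (mob (heckeMat n x) • τ) = jH τ} with hS
  have hS' (x : S) : x.1 ∈ heckeSet n := (Finset.mem_filter.mp x.2).1
  choose g hg using fun x : S ↦ exists_smul_eq_of_jH_eq (Finset.mem_filter.mp x.2).2
  have hmob (γ : SL(2, ℤ)) {x : Σ _ : ℕ, ℕ} (hx : x ∈ heckeSet n) :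
      mob (γ.1 * heckeMat n x) • τ = γ • mob (heckeMat n x) • τ := by
    rw [mob_mul_smul (by rw [γ.2]; norm_num) (heckeMat_det_pos hx), mob_coe_smul]
  let f (p : MulAction.stabilizer SL(2, ℤ) τ × S) : Matrix (Fin 2) (Fin 2) ℤ :=
    (p.1.1 * g p.2).1 * heckeMat n p.2
  have hf : f.Injective := by
    rintro ⟨δ, x⟩ ⟨ε, y⟩ h
    have h1 : (((ε.1 * g y)⁻¹ * (δ.1 * g x)).1 * heckeMat n x) = heckeMat n y := by
      rw [Matrix.SpecialLinearGroup.coe_mul, mul_assoc]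
      change _ * f (δ, x) = _
      rw [h, ← mul_assoc, ← Matrix.SpecialLinearGroup.coe_mul, inv_mul_cancel,
        Matrix.SpecialLinearGroup.coe_one, one_mul]
    obtain ⟨h2, h3⟩ := eq_of_mul_heckeMat_eq (hS' x) (hS' y) h1
    obtain rfl : x = y := Subtype.ext h3
    rw [inv_mul_eq_one, mul_left_inj] at h2
    rw [Subtype.ext h2]
  have hr : fixSet n τ = Set.range f := by
    refine Set.Subset.antisymm ?_ ?_
    · rintro A ⟨hA, hA'⟩
      obtain ⟨γ, x, hx, rfl⟩ := exists_eq_mul_heckeMat hn A hA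
      rw [hmob γ hx] at hA'
      have hxS : x ∈ S := Finset.mem_filter.mpr ⟨hx, by rw [← jH_smul γ, hA']⟩
      refine ⟨(⟨γ * (g ⟨x, hxS⟩)⁻¹, ?_⟩, ⟨x, hxS⟩), ?_⟩
      · rw [MulAction.mem_stabilizer_iff, mul_smul]
        conv_lhs => rw [← hg ⟨x, hxS⟩]
        rw [inv_smul_smul, hA']
      · change (γ * (g ⟨x, hxS⟩)⁻¹ * g ⟨x, hxS⟩).1 * heckeMat n x = _
        rw [inv_mul_cancel_right]
    · rintro _ ⟨⟨δ, x⟩, rfl⟩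
      refine ⟨?_, ?_⟩
      · rw [Matrix.det_mul, heckeMat_det (hS' x), (δ.1 * g x).2, one_mul]
      · rw [hmob _ (hS' x), mul_smul, hg]
        exact δ.2
  rw [hr, ← Nat.card_coe_set_eq, Nat.card_range_of_injective hf, Nat.card_prod, card_stabilizer,
    Nat.card_eq_fintype_card, Fintype.card_coe]

lemma ncard_traceSet {n : ℕ} (hn : n ≠ 0) (τ : ℍ) :
    (traceSet n τ).ncard + (if IsSquare (n : ℤ) then 1 else 0) =
      ramif (jH τ) * ((heckeFix n τ).card + if IsSquare (n : ℤ) then 1 else 0) := by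
  have h := (ncard_fixSet hn τ).symm.trans (ncard_fixSet' hn τ)
  rw [mul_assoc] at h
  split_ifs at h ⊢ <;> lia

/-- The form `Q ∘ g`. -/
def formComp (Q : ℤ × ℤ × ℤ) (g : SL(2, ℤ)) : ℤ × ℤ × ℤ :=
  (formVal Q (g.1 0 0) (g.1 1 0),
    2 * Q.1 * g.1 0 0 * g.1 0 1 + Q.2.1 * (g.1 0 0 * g.1 1 1 + g.1 0 1 * g.1 1 0) +
      2 * Q.2.2 * g.1 1 0 * g.1 1 1,
    formVal Q (g.1 0 1) (g.1 1 1))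

lemma formVal_formComp (Q : ℤ × ℤ × ℤ) (g : SL(2, ℤ)) (x y : ℤ) : formVal (formComp Q g) x y =
    formVal Q (g.1 0 0 * x + g.1 0 1 * y) (g.1 1 0 * x + g.1 1 1 * y) := by
  simp only [formComp, formVal]
  ring

lemma formVal_injective {Q Q' : ℤ × ℤ × ℤ} (h : ∀ x y, formVal Q x y = formVal Q' x y) :
    Q = Q' := by
  have h1 := h 1 0
  have h2 := h 0 1
  have h3 := h 1 1
  simp only [formVal] at h1 h2 h3
  ext <;> lia

lemma isForm_formComp {d : ℤ} (hd : 0 < d) {Q : ℤ × ℤ × ℤ} (hQ : IsForm d Q) (g : SL(2, ℤ)) :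
    IsForm d (formComp Q g) := by
  obtain ⟨h1, h2⟩ := hQ
  have hg := g.2
  rw [Matrix.det_fin_two] at hg
  refine ⟨?_, ?_⟩
  · have h3 : 4 * Q.1 * (formComp Q g).1 =
        (2 * Q.1 * g.1 0 0 + Q.2.1 * g.1 1 0) ^ 2 + d * g.1 1 0 ^ 2 := by
      simp only [formComp, formVal]
      linear_combination (- g.1 1 0 ^ 2) * h2
    refine pos_of_mul_pos_right (a := 4 * Q.1) ?_ (by lia)
    rw [h3]
    by_cases hc : g.1 1 0 = 0
    · have ha : g.1 0 0 ≠ 0 := fun ha ↦ by simp [ha, hc] at hg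
      rw [hc, mul_zero, add_zero]
      have := h1.ne'
      positivity
    · positivity
  · simp only [formComp, formVal]
    linear_combination (g.1 0 0 * g.1 1 1 - g.1 0 1 * g.1 1 0) ^ 2 * h2 -
      d * (g.1 0 0 * g.1 1 1 - g.1 0 1 * g.1 1 0 + 1) * hg

lemma formRoot_formComp {d : ℤ} (hd : 0 < d) {Q : ℤ × ℤ × ℤ} (hQ : IsForm d Q) {g : SL(2, ℤ)}
    {τ : ℍ} (h : formRoot Q = (g • τ : ℍ)) : formRoot (formComp Q g) = τ := by
  rw [formRoot_eq_iff hd hQ, UpperHalfPlane.coe_specialLinearGroup_apply] at h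
  rw [formRoot_eq_iff hd (isForm_formComp hd hQ g)]
  have hden : (g.1 1 0 : ℂ) * τ + g.1 1 1 ≠ 0 := fun h0 ↦ by
    obtain ⟨h1, h2⟩ := int_mul_add_eq_zero h0
    have hg := g.2
    rw [Matrix.det_fin_two, h1, h2] at hg
    simp at hg
  have hdiv {A B C x y : ℂ} (hy : y ≠ 0) (h : A * (x / y) ^ 2 + B * (x / y) + C = 0) :
      A * x ^ 2 + B * (x * y) + C * y ^ 2 = 0 := by
    have := congrArg (· * y ^ 2) h
    field_simp at this
    linear_combination this
  simp only [algebraMap_int_eq, eq_intCast, Complex.ofReal_intCast] at h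
  replace h := hdiv hden h
  simp only [formComp, formVal]
  push_cast
  linear_combination h

lemma formVal_eq_comp_iff {d : ℤ} (hd : 0 < d) {Q Q' : ℤ × ℤ × ℤ} (hQ : IsForm d Q)
    (hQ' : IsForm d Q') {τ τ' : ℍ} (h : formRoot Q = τ) (h' : formRoot Q' = τ') (g : SL(2, ℤ)) :
    (∀ x y, formVal Q' x y =
      formVal Q (g.1 0 0 * x + g.1 0 1 * y) (g.1 1 0 * x + g.1 1 1 * y)) ↔ g • τ' = τ := by
  simp only [← formVal_formComp]
  constructor
  · intro H
    have h1 : formRoot (formComp Q g) = (g⁻¹ • τ : ℍ) :=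
      formRoot_formComp hd hQ (by rw [smul_inv_smul, h])
    rw [← formVal_injective H, h'] at h1
    rw [UpperHalfPlane.ext h1, smul_inv_smul]
  · rintro rfl x y
    rw [form_eq_of_root hd hQ' (isForm_formComp hd hQ g) ((formRoot_eq_iff hd hQ' _).mp h')
      ((formRoot_eq_iff hd (isForm_formComp hd hQ g) _).mp (formRoot_formComp hd hQ h))]

lemma formRel_iff {d : ℤ} (hd : 0 < d) {Q Q' : ℤ × ℤ × ℤ} (hQ : IsForm d Q)
    (hQ' : IsForm d Q') : FormRel Q Q' ↔ jInv (formRoot Q) = jInv (formRoot Q') := by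
  obtain ⟨τ, h⟩ := exists_formRoot_eq hd hQ
  obtain ⟨τ', h'⟩ := exists_formRoot_eq hd hQ'
  rw [h, h', jInv_eq, jInv_eq]
  unfold FormRel
  simp only [formVal_eq_comp_iff hd hQ hQ' h h']
  refine ⟨?_, fun H ↦ exists_smul_eq_of_jH_eq H.symm⟩
  rintro ⟨g, rfl⟩
  exact jH_smul g τ'

lemma formWt_eq {d : ℤ} (hd : 0 < d) {Q : ℤ × ℤ × ℤ} (hQ : IsForm d Q) :
    formWt Q = ramif (jInv (formRoot Q)) := by
  obtain ⟨τ, h⟩ := exists_formRoot_eq hd hQ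
  unfold formWt
  simp only [formVal_eq_comp_iff hd hQ hQ h h]
  rw [h, jInv_eq]
  have := card_stabilizer τ
  change Nat.card { g : SL(2, ℤ) // g • τ = τ } = _ at this
  rw [this]
  lia

/-- The singular moduli of discriminant `-d`. -/
def singularSet (d : ℤ) : Set ℂ := {z | ∃ Q, IsForm d Q ∧ jInv (formRoot Q) = z}

lemma finsum_formClass {d : ℤ} (hd : 0 < d) :
    ∑ᶠ cl : FormClass d, (jInv (formRoot (Quot.out cl).1) - 744) / (formWt (Quot.out cl).1 : ℂ) =
      ∑ᶠ z ∈ singularSet d, (z - 744) / (ramif z : ℂ) := by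
  have hinj : Function.Injective fun cl : FormClass d ↦ jInv (formRoot (Quot.out cl).1) := by
    intro cl cl' h
    rw [← Quot.out_eq cl, ← Quot.out_eq cl']
    exact Quot.sound ((formRel_iff hd cl.out.2 cl'.out.2).mpr h)
  have hrange : singularSet d = Set.range fun cl : FormClass d ↦
      jInv (formRoot (Quot.out cl).1) := by
    refine Set.Subset.antisymm ?_ ?_
    · rintro z ⟨Q, hQ, rfl⟩
      let R (f f' : {f // IsForm d f}) := FormRel f.1 f'.1
      have hR : Equivalence R := by
        have hR' : R = fun f f' ↦ jInv (formRoot f.1) = jInv (formRoot f'.1) :=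
          funext₂ fun f f' ↦ propext (formRel_iff hd f.2 f'.2)
        rw [hR']
        exact ⟨fun _ ↦ rfl, Eq.symm, Eq.trans⟩
      have h1 : R (Quot.out (Quot.mk R ⟨Q, hQ⟩)) ⟨Q, hQ⟩ :=
        (Quot.eq.trans hR.eqvGen_iff).mp (Quot.out_eq _)
      exact ⟨Quot.mk _ ⟨Q, hQ⟩, (formRel_iff hd (Quot.out (Quot.mk R ⟨Q, hQ⟩)).2 hQ).mp h1⟩
    · rintro _ ⟨cl, rfl⟩
      exact ⟨_, cl.out.2, rfl⟩
  rw [hrange, finsum_mem_range hinj]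
  exact finsum_congr fun cl ↦ by rw [formWt_eq hd cl.out.2]

lemma traceSM_eq {n : ℕ} {r : ℤ} (hr : r ^ 2 < 4 * (n : ℤ)) : traceSM (4 * n - r ^ 2) =
    (∑ᶠ z ∈ singularSet (4 * n - r ^ 2), (z - 744) / (ramif z : ℂ)).re := by
  have h4 : r ^ 2 % 4 = 0 ∨ r ^ 2 % 4 = 1 := by
    rcases Int.even_or_odd' r with ⟨k, rfl | rfl⟩
    · left; ring_nf; lia
    · right; ring_nf; lia
  rw [traceSM, if_neg (by lia), if_neg (by lia), if_neg (by lia), finsum_formClass (by lia)]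

lemma mem_traceSet_iff {n : ℕ} {τ : ℍ} {r : ℤ} :
    r ∈ traceSet n τ ↔ r ^ 2 < 4 * (n : ℤ) ∧ jH τ ∈ singularSet (4 * n - r ^ 2) := by
  refine and_congr_right fun hr ↦ ⟨?_, ?_⟩
  · rintro ⟨Q, hQ, h⟩
    exact ⟨Q, hQ, by rw [h, jInv_eq]⟩
  · rintro ⟨Q, hQ, h⟩
    have hd : 0 < 4 * (n : ℤ) - r ^ 2 := by lia
    obtain ⟨τ', h'⟩ := exists_formRoot_eq hd hQ
    rw [h', jInv_eq] at h
    obtain ⟨g, rfl⟩ := exists_smul_eq_of_jH_eq h.symm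
    exact ⟨formComp Q g, isForm_formComp hd hQ g, formRoot_formComp hd hQ h'⟩

lemma singularSet_subset {n : ℕ} (hn : n ≠ 0) {p : Polynomial ℂ} (hp : p ≠ 0)
    (hm : ∀ τ, modProd n τ = p.eval (jH τ)) {r : ℤ} (hr : r ^ 2 < 4 * (n : ℤ)) :
    singularSet (4 * n - r ^ 2) ⊆ (p.roots.toFinset ∪ {0, 1728} : Finset ℂ) := by
  intro z hz
  obtain ⟨τ, rfl⟩ := exists_jH_eq z
  have h1 : 0 < (traceSet n τ).ncard :=
    (Set.ncard_pos (traceSet_finite n τ)).mpr ⟨r, mem_traceSet_iff.mpr ⟨hr, hz⟩⟩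
  have h2 := ncard_traceSet hn τ
  by_contra hF
  simp only [Finset.coe_union, Finset.coe_insert, Finset.coe_singleton, Set.mem_union,
    Finset.mem_coe, Multiset.mem_toFinset, Set.mem_insert_iff, Set.mem_singleton_iff, not_or] at hF
  rw [ramif, if_neg hF.2.1, if_neg hF.2.2, ← rootMultiplicity_of_modProd hp hm,
    ← Polynomial.count_roots, Multiset.count_eq_zero.mpr hF.1] at h2
  lia

lemma sum_ramif (F : Finset ℂ) (h : {0, 1728} ⊆ F) :
    ∑ z ∈ F, (z - 744) * (1 - 1 / (ramif z : ℂ)) = -4 := by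
  rw [← Finset.sum_subset h, Finset.sum_pair (by norm_num)]
  · norm_num [ramif]
  · intro z _ hz
    simp only [Finset.mem_insert, Finset.mem_singleton, not_or] at hz
    simp [ramif, hz.1, hz.2]

lemma sum_roots (p : Polynomial ℂ) (F : Finset ℂ) (h : p.roots.toFinset ⊆ F) :
    ∑ z ∈ F, (z - 744) * (p.rootMultiplicity z : ℂ) = (p.roots.map fun x ↦ x - 744).sum := by
  rw [Finset.sum_multiset_map_count, ← Finset.sum_subset h]
  · exact Finset.sum_congr rfl fun z _ ↦ by rw [Polynomial.count_roots, nsmul_eq_mul, mul_comm]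
  · intro z _ hz
    rw [Multiset.mem_toFinset] at hz
    rw [← Polynomial.count_roots, Multiset.count_eq_zero.mpr hz, Nat.cast_zero, mul_zero]

lemma not_isSquare_four_mul_add_one {n : ℤ} (hn : 0 < n) (h : IsSquare n) :
    ¬IsSquare (4 * n + 1) := by
  rintro ⟨k, hk⟩
  obtain ⟨m, rfl⟩ := h
  have h1 : (2 * m) ^ 2 < k ^ 2 := by linarith
  have h2 : k ^ 2 < (2 * |m| + 1) ^ 2 := by
    have : 0 < |m| := abs_pos.mpr fun h ↦ by simp [h] at hn
    nlinarith [sq_abs m]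
  have h1' := sq_lt_sq.mp h1
  have h2' := sq_lt_sq.mp h2
  rw [abs_mul] at h1'
  rw [abs_of_nonneg (by positivity : (0 : ℤ) ≤ 2 * |m| + 1)] at h2'
  norm_num at h1'
  lia

open scoped Classical in
lemma finsum_traceSM {n : ℕ} (F : Finset ℂ)
    (hF : ∀ r : ℤ, r ^ 2 < 4 * (n : ℤ) → singularSet (4 * n - r ^ 2) ⊆ F) :
    (∑ᶠ (r : ℤ) (_ : r ^ 2 < 4 * (n : ℤ)), traceSM (4 * n - r ^ 2)) =
      (∑ z ∈ F, {r : ℤ | r ^ 2 < 4 * (n : ℤ) ∧ z ∈ singularSet (4 * n - r ^ 2)}.ncard *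
        ((z - 744) / (ramif z : ℂ))).re := by
  have hfin : {r : ℤ | r ^ 2 < 4 * (n : ℤ)}.Finite :=
    (Set.finite_Icc (-(4 * n) : ℤ) (4 * n)).subset fun r (hr : r ^ 2 < 4 * (n : ℤ)) ↦
      ⟨by nlinarith, by nlinarith⟩
  set R := hfin.toFinset with hR
  have hmem {r : ℤ} : r ∈ R ↔ r ^ 2 < 4 * (n : ℤ) := by simp [hR]
  have h1 : (∑ᶠ (r : ℤ) (_ : r ^ 2 < 4 * (n : ℤ)), traceSM (4 * n - r ^ 2)) =
      ∑ r ∈ R, traceSM (4 * n - r ^ 2) := by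
    rw [← finsum_mem_finset_eq_sum]
    simp only [hmem]
  have h2 : ∀ r ∈ R, traceSM (4 * n - r ^ 2) = (∑ z ∈ F,
      if z ∈ singularSet (4 * n - r ^ 2) then (z - 744) / (ramif z : ℂ) else 0).re := by
    intro r hr
    rw [traceSM_eq (hmem.mp hr), ← Finset.sum_filter, ← finsum_mem_finset_eq_sum]
    congr 1
    refine finsum_congr fun z ↦ ?_
    rw [Finset.mem_filter, and_iff_right_of_imp fun hz ↦ Finset.mem_coe.mp (hF r (hmem.mp hr) hz)]
  rw [h1, Finset.sum_congr rfl h2, ← Complex.re_sum, Finset.sum_comm]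
  congr 1
  refine Finset.sum_congr rfl fun z _ ↦ ?_
  rw [← Finset.sum_filter, Finset.sum_const, nsmul_eq_mul, ← Set.ncard_coe_finset]
  congr 3
  ext r
  simp [hmem]

end ZagierTrace

open scoped Classical in
/-- Zagier's identity: `∑_{|r| < 2√n} t(4n − r²)` is `-4`, `2` or `0` according as `n` is a
square, `4n+1` is a square, or neither. -/
theorem zagier_trace_identity (n : ℕ) (hn : 0 < n) :
    (∑ᶠ (r : ℤ) (_ : r ^ 2 < 4 * (n : ℤ)), traceSM (4 * n - r ^ 2)) =
      if IsSquare (n : ℤ) then -4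
      else if IsSquare (4 * (n : ℤ) + 1) then 2
      else 0 := by
  open ZagierTrace in
  obtain ⟨p, hp, hm, hsum⟩ := exists_modProd_eq_eval hn.ne'
  set F : Finset ℂ := p.roots.toFinset ∪ {0, 1728} with hF
  rw [finsum_traceSM F fun r hr ↦ singularSet_subset hn.ne' hp hm hr]
  have key : ∀ z ∈ F, ({r : ℤ | r ^ 2 < 4 * (n : ℤ) ∧ z ∈ singularSet (4 * n - r ^ 2)}.ncard : ℂ) *
      ((z - 744) / (ramif z : ℂ)) = (z - 744) * (p.rootMultiplicity z : ℂ) +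
        (if IsSquare (n : ℤ) then 1 else 0) * ((z - 744) * (1 - 1 / (ramif z : ℂ))) := by
    intro z _
    obtain ⟨τ, rfl⟩ := exists_jH_eq z
    have h : {r : ℤ | r ^ 2 < 4 * (n : ℤ) ∧ jH τ ∈ singularSet (4 * n - r ^ 2)} = traceSet n τ :=
      Set.ext fun r ↦ mem_traceSet_iff.symm
    have h1 := congrArg (Nat.cast (R := ℂ)) (ncard_traceSet hn.ne' τ)
    rw [← rootMultiplicity_of_modProd hp hm] at h1
    push_cast at h1
    have hw : (ramif (jH τ) : ℂ) ≠ 0 := by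
      unfold ramif
      split_ifs <;> norm_num
    rw [h]
    field_simp
    linear_combination (jH τ - 744) * h1
  rw [Finset.sum_congr rfl key, Finset.sum_add_distrib, ← Finset.mul_sum,
    sum_ramif F Finset.subset_union_right, sum_roots p F Finset.subset_union_left, hsum]
  have hne := not_isSquare_four_mul_add_one (n := n) (by exact_mod_cast hn)
  split_ifs with h1 h2 <;> first | exact absurd h1 (hne h2) | simp
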